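/- arXiv:1606.00038 — 2 statements merged into one kernel-verified Lean document; each statement's English description precedes it below -/
import Mathlib

section
/- Let G be a finite group with |G| = |L₃(67)| = 2⁴·3²·7²·11²·17·31·67³ and degree pattern D(G) = D(L₃(67)) = (4,2,1,4,2,1,2), i.e., deg_G(2)=4, deg_G(3)=2, deg_G(7)=1, deg_G(11)=4, deg_G(17)=2, deg_G(31)=1, deg_G(67)=2. Then G is isomorphic to L₃(67). -/
open scoped MatrixGroups

/-- Two distinct primes `p` and `q` dividing `|G|` are adjacent in the prime graph `Γ(G)`
of a finite group `G` iff `G` has an element of order `p * q`. -/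
def primeGraphAdj (G : Type*) [Group G] (p q : ℕ) : Prop :=
  p ≠ q ∧ p.Prime ∧ q.Prime ∧ p ∣ Nat.card G ∧ q ∣ Nat.card G ∧ ∃ g : G, orderOf g = p * q

open scoped Classical in
/-- The degree of a vertex `p` in the prime graph of `G`: the number of primes dividing `|G|`
that are adjacent to `p`. -/
noncomputable def primeGraphDeg (G : Type*) [Group G] (p : ℕ) : ℕ :=
  ((Nat.card G).primeFactors.filter (fun r => primeGraphAdj G p r)).card

open scoped Pointwise
set_option linter.unusedSectionVars false
set_option linter.deprecated false
namespace OD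

structure Hyp (G : Type*) [Group G] (p : ℕ) : Prop where
  hp3 : 3 ≤ p
  card : ∀ P : Sylow p G, Nat.card (P : Subgroup G) = p ^ 3
  nonab : ∀ P : Sylow p G, ¬ ∀ x ∈ (P : Subgroup G), ∀ y ∈ (P : Subgroup G), x * y = y * x
  hK : ∀ P : Sylow p G, ∀ x ∈ (P : Subgroup G), (∀ y ∈ (P : Subgroup G), y * x = x * y) → x ≠ 1 →
    ∀ y : G, x * y = y * x → (∃ k : ℕ, y ^ p ^ k = 1) → y ∈ (P : Subgroup G)
  nS : Nat.card (Sylow p G) = (p + 1) * (p ^ 2 + p + 1)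
  h8 : ∀ P : Sylow p G, ¬ 8 ∣ Nat.card (Subgroup.normalizer (P : Set G))

variable {G : Type*} [Group G]

/-- The center of a subgroup, as a subgroup of the big group. -/
def Zc (P : Subgroup G) : Subgroup G := P ⊓ Subgroup.centralizer (P : Set G)

theorem mem_Zc {P : Subgroup G} {x : G} : x ∈ Zc P ↔ x ∈ P ∧ ∀ y ∈ P, y * x = x * y := by
  unfold Zc
  rw [Subgroup.mem_inf, Subgroup.mem_centralizer_iff]
  rfl

theorem Zc_le (P : Subgroup G) : Zc P ≤ P := inf_le_left

theorem Zc_eq_map (P : Subgroup G) : Zc P = (Subgroup.center P).map P.subtype := by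
  ext x
  rw [mem_Zc, Subgroup.mem_map]
  constructor
  · rintro ⟨h1, h2⟩
    refine ⟨⟨x, h1⟩, ?_, rfl⟩
    rw [Subgroup.mem_center_iff]
    intro g
    exact Subtype.ext (h2 g g.2)
  · rintro ⟨y, hy, rfl⟩
    refine ⟨y.2, ?_⟩
    intro z hz
    rw [Subgroup.mem_center_iff] at hy
    exact congrArg Subtype.val (hy ⟨z, hz⟩)

theorem mem_conj {g x : G} {H : Subgroup G} : x ∈ MulAut.conj g • H ↔ g⁻¹ * x * g ∈ H := by
  rw [Subgroup.mem_pointwise_smul_iff_inv_smul_mem]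
  simp [← map_inv, MulAut.smul_def]

theorem Zc_conj (g : G) (H : Subgroup G) : Zc (MulAut.conj g • H) = MulAut.conj g • Zc H := by
  ext x
  rw [mem_conj, mem_Zc, mem_Zc, mem_conj]
  refine and_congr_right fun _ => ⟨fun h y hy => ?_, fun h y hy => ?_⟩
  · have := h (g * y * g⁻¹) (by rw [mem_conj]; simpa [mul_assoc] using hy)
    calc y * (g⁻¹ * x * g) = g⁻¹ * (g * y * g⁻¹ * x) * g := by group
      _ = _ := by rw [this]; group
  · rw [mem_conj] at hy
    have := h _ hy
    calc y * x = g * (g⁻¹ * y * g * (g⁻¹ * x * g)) * g⁻¹ := by group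
      _ = _ := by rw [this]; group

theorem card_conj (g : G) (H : Subgroup G) :
    Nat.card (MulAut.conj g • H : Subgroup G) = Nat.card H := by
  exact (Nat.card_congr (Subgroup.equivSMul (MulAut.conj g) H).toEquiv).symm

section
variable [Finite G] {p : ℕ} [Fact p.Prime]

theorem Hyp.card_Zc (H : Hyp G p) (P : Sylow p G) : Nat.card (Zc (P : Subgroup G)) = p := by
  have hp : p.Prime := Fact.out
  have h3 := H.card P
  rw [Zc_eq_map, Nat.card_congr (Subgroup.equivMapOfInjective _ _ (Subgroup.subtype_injective _)).symm.toEquiv]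
  have hna : ¬ ∀ x y : (P : Subgroup G), x * y = y * x := by
    intro h
    apply H.nonab P
    intro x hx y hy
    exact congrArg Subtype.val (h ⟨x, hx⟩ ⟨y, hy⟩)
  obtain ⟨k, hk0, hk⟩ := IsPGroup.card_center_eq_prime_pow (p := p) (G := (P : Subgroup G)) h3 (by norm_num)
  have hmul := Subgroup.card_mul_index (Subgroup.center (P : Subgroup G))
  rw [hk, h3] at hmul
  have hk3 : k ≤ 3 := (Nat.pow_dvd_pow_iff_le_right hp.one_lt).1 ⟨_, hmul.symm⟩
  have hcyc : ¬ IsCyclic ((P : Subgroup G) ⧸ Subgroup.center (P : Subgroup G)) := by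
    intro hc
    apply hna
    exact commutative_of_cyclic_center_quotient (QuotientGroup.mk' (Subgroup.center (P : Subgroup G))) (by simp)
  rw [hk]
  interval_cases k
  · simp
  · exfalso
    apply hcyc
    have : (Subgroup.center (P : Subgroup G)).index = p := by
      have : p ^ 2 * (Subgroup.center (P : Subgroup G)).index = p ^ 2 * p := by rw [hmul]; ring
      exact Nat.eq_of_mul_eq_mul_left (pow_pos hp.pos 2) this
    exact isCyclic_of_prime_card (p := p) this
  · exfalso
    apply hcyc
    have : (Subgroup.center (P : Subgroup G)).index = 1 := by
      have : p ^ 3 * (Subgroup.center (P : Subgroup G)).index = p ^ 3 * 1 := by rw [hmul]; ring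
      exact Nat.eq_of_mul_eq_mul_left (pow_pos hp.pos 3) this
    have : Subsingleton ((P : Subgroup G) ⧸ Subgroup.center (P : Subgroup G)) :=
      (Nat.card_eq_one_iff_unique.1 this).1
    infer_instance

theorem ppow (P : Sylow p G) {x : G} (hx : x ∈ (P : Subgroup G)) : ∃ k : ℕ, x ^ p ^ k = 1 := by
  obtain ⟨k, hk⟩ := P.isPGroup' ⟨x, hx⟩
  exact ⟨k, congrArg Subtype.val hk⟩

theorem Sylow_eq_of_le {P Q : Sylow p G} (h : (P : Subgroup G) ≤ Q) : P = Q :=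
  Sylow.ext (P.is_maximal' Q.isPGroup' h).symm

theorem Hyp.mem_of_comm (H : Hyp G p) {P Q : Sylow p G} {x y : G} (hx : x ∈ Zc (P : Subgroup G))
    (hx1 : x ≠ 1) (hy : y ∈ (Q : Subgroup G)) (hc : x * y = y * x) : y ∈ (P : Subgroup G) :=
  H.hK P x (mem_Zc.1 hx).1 (mem_Zc.1 hx).2 hx1 y hc (ppow Q hy)

theorem Hyp.Zc_disj (H : Hyp G p) {P Q : Sylow p G} {x : G} (hx : x ∈ Zc (P : Subgroup G))
    (hx' : x ∈ Zc (Q : Subgroup G)) (hx1 : x ≠ 1) : P = Q := by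
  apply Sylow.ext
  apply le_antisymm
  · intro y hy
    exact H.mem_of_comm hx' hx1 hy ((mem_Zc.1 hx).2 y hy).symm
  · intro y hy
    exact H.mem_of_comm hx hx1 hy ((mem_Zc.1 hx').2 y hy).symm

theorem coe_smul (g : G) (P : Sylow p G) :
    ((g • P : Sylow p G) : Subgroup G) = MulAut.conj g • (P : Subgroup G) := rfl

theorem mem_smul {g x : G} {P : Sylow p G} :
    x ∈ ((g • P : Sylow p G) : Subgroup G) ↔ g⁻¹ * x * g ∈ (P : Subgroup G) := by
  rw [coe_smul, mem_conj]

/-- an element moving a central element into the centre normalises -/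
theorem Hyp.smul_eq_of (H : Hyp G p) {P Q : Sylow p G} {g x : G} (hx : x ∈ Zc (P : Subgroup G))
    (hx1 : x ≠ 1) (hg : g * x * g⁻¹ ∈ Zc (Q : Subgroup G)) : g • P = Q := by
  apply H.Zc_disj (x := g * x * g⁻¹) _ hg
  · intro h
    apply hx1
    exact conj_eq_one_iff.1 h
  · rw [coe_smul, Zc_conj, mem_conj]
    simpa [mul_assoc] using hx

theorem Hyp.comm_mem (H : Hyp G p) (Q : Sylow p G) {a b : G} (ha : a ∈ (Q : Subgroup G))
    (hb : b ∈ (Q : Subgroup G)) : a * b * a⁻¹ * b⁻¹ ∈ Zc (Q : Subgroup G) := by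
  have hp : p.Prime := Fact.out
  have hc := H.card_Zc Q
  rw [Zc_eq_map, Nat.card_congr (Subgroup.equivMapOfInjective _ _ (Subgroup.subtype_injective _)).symm.toEquiv] at hc
  have hmul := Subgroup.card_mul_index (Subgroup.center (Q : Subgroup G))
  rw [hc, H.card Q] at hmul
  have h2 : (Subgroup.center (Q : Subgroup G)).index = p ^ 2 := by
    have : p * (Subgroup.center (Q : Subgroup G)).index = p * p ^ 2 := by rw [hmul]; ring
    exact Nat.eq_of_mul_eq_mul_left hp.pos this
  have := IsPGroup.commutative_of_card_eq_prime_sq (p := p)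
    (G := (Q : Subgroup G) ⧸ Subgroup.center (Q : Subgroup G)) h2
  have h3 := this (QuotientGroup.mk ⟨a, ha⟩) (QuotientGroup.mk ⟨b, hb⟩)
  rw [Zc_eq_map, Subgroup.mem_map]
  refine ⟨⟨a, ha⟩ * ⟨b, hb⟩ * ⟨a, ha⟩⁻¹ * ⟨b, hb⟩⁻¹, ?_, rfl⟩
  rw [← QuotientGroup.eq_one_iff]
  simp only [QuotientGroup.mk_mul, QuotientGroup.mk_inv]
  rw [h3]; group

theorem comm_of_card_sq {E : Subgroup G} (hE : Nat.card E = p ^ 2) {x y : G} (hx : x ∈ E)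
    (hy : y ∈ E) : x * y = y * x := by
  have := IsPGroup.commutative_of_card_eq_prime_sq (p := p) (G := E) hE
  exact congrArg Subtype.val (this ⟨x, hx⟩ ⟨y, hy⟩)

theorem sub_eq_of_card {E F : Subgroup G} (h : E ≤ F) (hc : Nat.card F ≤ Nat.card E) : E = F :=
  Subgroup.eq_of_le_of_card_ge h hc

/-- subgroups between a subgroup of order `p^2` and one of order `p^3` -/
theorem mid {E F Q : Subgroup G} (hE : Nat.card E = p ^ 2) (hQ : Nat.card Q = p ^ 3)
    (h1 : E ≤ F) (h2 : F ≤ Q) : E = F ∨ F = Q := by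
  have hp : p.Prime := Fact.out
  have d2 := Subgroup.card_dvd_of_le h2
  have d1 := Subgroup.card_dvd_of_le h1
  rw [hQ] at d2
  rw [hE] at d1
  obtain ⟨k, hk, hk'⟩ := (Nat.dvd_prime_pow hp).1 d2
  rw [hk', Nat.pow_dvd_pow_iff_le_right hp.one_lt] at d1
  interval_cases k
  · left; exact sub_eq_of_card h1 (by rw [hk', hE])
  · right; exact sub_eq_of_card h2 (by rw [hk', hQ])

/-- L3 -/
theorem Hyp.cent_sq (H : Hyp G p) {E : Subgroup G} {Q : Sylow p G} (hE : Nat.card E = p ^ 2)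
    (hEQ : E ≤ Q) {x : G} (hx : x ∈ (Q : Subgroup G)) (hc : ∀ y ∈ E, y * x = x * y) : x ∈ E := by
  have hp : p.Prime := Fact.out
  have h1 : E ≤ (Q : Subgroup G) ⊓ Subgroup.centralizer (E : Set G) := by
    refine le_inf hEQ ?_
    intro y hy
    rw [Subgroup.mem_centralizer_iff]
    intro z hz
    exact comm_of_card_sq hE hz hy
  rcases mid hE (H.card Q) h1 inf_le_left with h | h
  · rw [h]
    exact Subgroup.mem_inf.2 ⟨hx, Subgroup.mem_centralizer_iff.2 hc⟩
  · exfalso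
    have : E ≤ Zc (Q : Subgroup G) := by
      intro y hy
      rw [mem_Zc]
      refine ⟨hEQ hy, fun z hz => ?_⟩
      rw [← h] at hz
      exact (Subgroup.mem_centralizer_iff.1 (Subgroup.mem_inf.1 hz).2 y hy).symm
    have := Subgroup.card_le_of_le this
    rw [hE, H.card_Zc] at this
    nlinarith [hp.two_le]

/-- L1 -/
theorem Hyp.Zc_le_sq (H : Hyp G p) {E : Subgroup G} {Q : Sylow p G} (hE : Nat.card E = p ^ 2)
    (hEQ : E ≤ Q) : Zc (Q : Subgroup G) ≤ E := by
  intro x hx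
  rw [mem_Zc] at hx
  exact H.cent_sq hE hEQ hx.1 fun y hy => hx.2 y (hEQ hy)

/-- L2 -/
theorem Hyp.conj_mem_sq (H : Hyp G p) {E : Subgroup G} {Q : Sylow p G} (hE : Nat.card E = p ^ 2)
    (hEQ : E ≤ Q) {a e : G} (ha : a ∈ (Q : Subgroup G)) (he : e ∈ E) : a * e * a⁻¹ ∈ E := by
  have h1 := H.Zc_le_sq hE hEQ (H.comm_mem Q ha (hEQ he))
  simpa using E.mul_mem h1 he

theorem conj_eq_of_le {g : G} {E : Subgroup G} (h : ∀ e ∈ E, g * e * g⁻¹ ∈ E) :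
    MulAut.conj g • E = E := by
  apply sub_eq_of_card
  · intro x hx
    rw [mem_conj] at hx
    simpa [mul_assoc] using h _ hx
  · rw [card_conj]

theorem Hyp.conj_sq (H : Hyp G p) {E : Subgroup G} {Q : Sylow p G} (hE : Nat.card E = p ^ 2)
    (hEQ : E ≤ Q) {a : G} (ha : a ∈ (Q : Subgroup G)) : MulAut.conj a • E = E :=
  conj_eq_of_le fun _ he => H.conj_mem_sq hE hEQ ha he

theorem Hyp.exists_Zc (H : Hyp G p) (P : Sylow p G) : ∃ x ∈ Zc (P : Subgroup G), x ≠ 1 := by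
  have hp : p.Prime := Fact.out
  have : Zc (P : Subgroup G) ≠ ⊥ := by
    intro h
    have := H.card_Zc P
    rw [h, Subgroup.card_bot] at this
    exact hp.one_lt.ne this
  obtain ⟨x, hx⟩ := Subgroup.ne_bot_iff_exists_ne_one.1 this
  exact ⟨x, x.2, by simpa using hx⟩
end
end OD

namespace OD
variable {G : Type*} [Group G] [Finite G] {p : ℕ} [Fact p.Prime]

theorem stab_card (P Q : Sylow p G) :
    Nat.card (MulAction.stabilizer (P : Subgroup G) Q) = Nat.card ((P : Subgroup G) ⊓ Q : Subgroup G) := by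
  have h : (MulAction.stabilizer (P : Subgroup G) Q).map (P : Subgroup G).subtype
      = (P : Subgroup G) ⊓ Q := by
    rw [← IsPGroup.inf_normalizer_sylow P.isPGroup' Q]
    ext x
    simp only [Subgroup.mem_map, Subgroup.mem_inf, MulAction.mem_stabilizer_iff]
    constructor
    · rintro ⟨y, hy, rfl⟩
      exact ⟨y.2, Sylow.smul_eq_iff_mem_normalizer.1 hy⟩
    · rintro ⟨h1, h2⟩
      exact ⟨⟨x, h1⟩, Sylow.smul_eq_iff_mem_normalizer.2 h2, rfl⟩
  rw [← h]
  exact Nat.card_congr (Subgroup.equivMapOfInjective _ _ (Subgroup.subtype_injective _)).toEquiv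

theorem orbit_card (P Q : Sylow p G) :
    (MulAction.orbit (P : Subgroup G) Q).ncard * Nat.card ((P : Subgroup G) ⊓ Q : Subgroup G)
      = Nat.card (P : Subgroup G) := by
  classical
  rw [← stab_card, ← MulAction.index_stabilizer, mul_comm, Subgroup.card_mul_index]

/-- Good subgroups: order `p^2` and contained in two Sylow subgroups. -/
def Good (p : ℕ) (E : Subgroup G) : Prop :=
  Nat.card E = p ^ 2 ∧ ∃ P Q : Sylow p G, P ≠ Q ∧ E ≤ P ∧ E ≤ Q

theorem Hyp.eq_inf (H : Hyp G p) {E : Subgroup G} (hE : Nat.card E = p ^ 2) {P Q : Sylow p G}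
    (hPQ : P ≠ Q) (hP : E ≤ P) (hQ : E ≤ Q) : E = (P : Subgroup G) ⊓ Q := by
  rcases mid hE (H.card P) (le_inf hP hQ) inf_le_left with h | h
  · exact h
  · exact absurd (Sylow_eq_of_le (inf_eq_left.1 h)) hPQ

theorem sub_sdiff_card (S T : Subgroup G) (h : T ≤ S) :
    ((S : Set G) \ T).ncard + Nat.card T = Nat.card S := by
  have := Set.ncard_sdiff_add_ncard_of_subset (s := (T : Set G)) (t := S) h (Set.toFinite _)
  exact this

theorem Hyp.Good_aux (H : Hyp G p) {E : Subgroup G} (hE : Good p E) :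
    {Q : Sylow p G | E ≤ Q}.ncard = p + 1 ∧
    ∀ x ∈ E, x ≠ 1 → ∃ Q : Sylow p G, E ≤ Q ∧ x ∈ Zc (Q : Subgroup G) := by
  classical
  have hp : p.Prime := Fact.out
  obtain ⟨hc, P, Q, hPQ, hP, hQ⟩ := hE
  have := Fintype.ofFinite G
  have : Fintype (Sylow p G) := Fintype.ofFinite _
  set S : Finset (Sylow p G) := {Q : Sylow p G | E ≤ Q} with hS
  have hS' : {Q : Sylow p G | E ≤ Q}.ncard = S.card := by
    rw [← Set.ncard_coe_finset]; congr 1; ext; simp [hS]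
  -- lower bound
  have hlow : p + 1 ≤ S.card := by
    have ho := orbit_card P Q
    rw [← H.eq_inf hc hPQ hP hQ, hc, H.card P] at ho
    have ho : (MulAction.orbit (P : Subgroup G) Q).ncard = p := by
      have : (MulAction.orbit (P : Subgroup G) Q).ncard * p ^ 2 = p * p ^ 2 := by rw [ho]; ring
      exact Nat.eq_of_mul_eq_mul_right (pow_pos hp.pos 2) this
    have hni : P ∉ MulAction.orbit (P : Subgroup G) Q := by
      rintro ⟨g, hg⟩
      apply hPQ
      have : (g : G) • Q = P := hg
      have h2 : (g : G)⁻¹ • P = Q := inv_smul_eq_iff.2 this.symm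
      rw [← h2]
      symm
      exact Sylow.smul_eq_iff_mem_normalizer.2
        (Subgroup.le_normalizer ((P : Subgroup G).inv_mem g.2))
    have h3 : (insert P (MulAction.orbit (P : Subgroup G) Q)).ncard = p + 1 := by
      rw [Set.ncard_insert_of_notMem hni (Set.toFinite _), ho]
    rw [← h3, ← hS']
    apply Set.ncard_le_ncard _ (Set.toFinite _)
    rintro R (rfl | ⟨g, rfl⟩)
    · exact hP
    · intro x hx
      change x ∈ (((g : G) • Q : Sylow p G) : Subgroup G)
      rw [mem_smul]
      apply hQ
      have := H.conj_mem_sq hc hP ((P : Subgroup G).inv_mem g.2) hx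
      simpa using this
  -- the sets of central elements
  set f : Sylow p G → Finset G := fun Q => {x | x ∈ Zc (Q : Subgroup G) ∧ x ≠ 1} with hf
  have hfc : ∀ Q, (f Q).card = p - 1 := by
    intro Q
    have := sub_sdiff_card (Zc (Q : Subgroup G)) ⊥ bot_le
    rw [H.card_Zc, Subgroup.card_bot] at this
    rw [← Set.ncard_coe_finset]
    have h2 : ((f Q : Finset G) : Set G) = (Zc (Q : Subgroup G) : Set G) \ ((⊥ : Subgroup G) : Set G) := by
      ext; simp [hf]
    rw [h2]; omega
  have hdis : (S.biUnion f).card = S.card * (p - 1) := by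
    rw [Finset.card_biUnion]
    · simp [hfc]
    · intro A _ B _ hAB
      refine Finset.disjoint_left.2 ?_
      intro x hx hx'
      simp only [hf, Finset.mem_filter, Finset.mem_univ, true_and] at hx hx'
      exact hAB (H.Zc_disj hx.1 hx'.1 hx.2)
  set T : Finset G := {x | x ∈ E ∧ x ≠ 1} with hT
  have hTc : T.card = p ^ 2 - 1 := by
    have := sub_sdiff_card E ⊥ bot_le
    rw [hc, Subgroup.card_bot] at this
    rw [← Set.ncard_coe_finset]
    have h2 : (T : Set G) = (E : Set G) \ ((⊥ : Subgroup G) : Set G) := by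
      ext; simp [hT]
    rw [h2]; omega
  have hsub : S.biUnion f ⊆ T := by
    intro x hx
    simp only [hf, hS, hT, Finset.mem_biUnion, Finset.mem_filter, Finset.mem_univ, true_and] at hx ⊢
    obtain ⟨R, hR, hx, hx1⟩ := hx
    exact ⟨H.Zc_le_sq hc hR hx, hx1⟩
  obtain ⟨q, rfl⟩ : ∃ q, p = q + 1 := ⟨p - 1, by have := hp.pos; omega⟩
  have hq : 0 < q := by have := hp.two_le; omega
  have hle := Finset.card_le_card hsub
  have e1 : (q + 1) ^ 2 - 1 = (q + 2) * q := by
    have : (q + 1) ^ 2 = (q + 2) * q + 1 := by ring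
    omega
  rw [hdis, hTc, e1, Nat.add_sub_cancel] at hle
  have hle2 : S.card ≤ q + 2 := Nat.le_of_mul_le_mul_right hle hq
  have hSc : S.card = q + 2 := by omega
  refine ⟨by rw [hS', hSc], ?_⟩
  have heq : S.biUnion f = T := by
    apply Finset.eq_of_subset_of_card_le hsub
    rw [hdis, hTc, e1, hSc, Nat.add_sub_cancel]
  intro x hx hx1
  have : x ∈ T := by simp [hT, hx, hx1]
  rw [← heq] at this
  simp only [hf, hS, Finset.mem_biUnion, Finset.mem_filter, Finset.mem_univ, true_and] at this
  obtain ⟨R, hR, hx, _⟩ := this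
  exact ⟨R, hR, hx⟩

theorem Hyp.Good_card (H : Hyp G p) {E : Subgroup G} (hE : Good p E) :
    {Q : Sylow p G | E ≤ Q}.ncard = p + 1 := (H.Good_aux hE).1

theorem Hyp.Good_cover (H : Hyp G p) {E : Subgroup G} (hE : Good p E) {x : G} (hx : x ∈ E)
    (hx1 : x ≠ 1) : ∃ Q : Sylow p G, E ≤ Q ∧ x ∈ Zc (Q : Subgroup G) := (H.Good_aux hE).2 x hx hx1

theorem Hyp.Good_exp (H : Hyp G p) {E : Subgroup G} (hE : Good p E) {x : G} (hx : x ∈ E) :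
    x ^ p = 1 := by
  by_cases hx1 : x = 1
  · simp [hx1]
  obtain ⟨Q, hQ, hxQ⟩ := H.Good_cover hE hx hx1
  have : (⟨x, hxQ⟩ : Zc (Q : Subgroup G)) ^ Nat.card (Zc (Q : Subgroup G)) = 1 := pow_card_eq_one'
  rw [H.card_Zc] at this
  exact congrArg Subtype.val this

/-- two subgroups of order `p^2` in a Sylow subgroup meet in the centre. -/
theorem Hyp.inf_eq_Zc (H : Hyp G p) {E F : Subgroup G} {P : Sylow p G} (hE : Nat.card E = p ^ 2)
    (hF : Nat.card F = p ^ 2) (hEP : E ≤ P) (hFP : F ≤ P) (hne : E ≠ F) :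
    E ⊓ F = Zc (P : Subgroup G) := by
  have hp : p.Prime := Fact.out
  symm
  have h1 : Zc (P : Subgroup G) ≤ E ⊓ F := le_inf (H.Zc_le_sq hE hEP) (H.Zc_le_sq hF hFP)
  apply sub_eq_of_card h1
  rw [H.card_Zc]
  have d1 := Subgroup.card_dvd_of_le (inf_le_left : E ⊓ F ≤ E)
  rw [hE] at d1
  obtain ⟨k, hk, hk'⟩ := (Nat.dvd_prime_pow hp).1 d1
  interval_cases k
  · rw [hk']; simpa using hp.one_lt.le
  · rw [hk']; simp
  · exfalso
    have h2 := sub_eq_of_card (inf_le_left : E ⊓ F ≤ E) (by rw [hk', hE])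
    have h3 := sub_eq_of_card (inf_le_right : E ⊓ F ≤ F) (by rw [hk', hF])
    exact hne (h2.symm.trans h3)

theorem dvd_card_of_orbit {K X : Type*} [Group K] [MulAction K X] (A : Finset X) (d : ℕ)
    (hinv : ∀ (k : K), ∀ x ∈ A, k • x ∈ A) (h : ∀ x ∈ A, d ∣ (MulAction.orbit K x).ncard) :
    d ∣ A.card := by
  classical
  rw [Finset.card_eq_sum_card_image (fun x => MulAction.orbit K x) A]
  apply Finset.dvd_sum
  intro b hb
  obtain ⟨x, hx, rfl⟩ := Finset.mem_image.1 hb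
  have : ((A.filter fun a => MulAction.orbit K a = MulAction.orbit K x : Finset X) : Set X)
      = MulAction.orbit K x := by
    ext y
    simp only [Finset.coe_filter, Set.mem_setOf_eq, MulAction.orbit_eq_iff]
    constructor
    · exact fun h => h.2
    · rintro ⟨k, rfl⟩
      exact ⟨hinv k x hx, k, rfl⟩
  rw [← Set.ncard_coe_finset, this]
  exact h x hx

theorem card_inf_smul (P Q : Sylow p G) (g : (P : Subgroup G)) :
    Nat.card ((P : Subgroup G) ⊓ (g • Q : Sylow p G) : Subgroup G)
      = Nat.card ((P : Subgroup G) ⊓ Q : Subgroup G) := by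
  have h1 := orbit_card P Q
  have h2 := orbit_card P (g • Q)
  rw [MulAction.orbit_smul, ← h1] at h2
  apply Nat.eq_of_mul_eq_mul_left _ h2
  rw [Set.ncard_pos]
  exact MulAction.nonempty_orbit _

/-- Each Sylow subgroup contains exactly two good subgroups. -/
theorem Hyp.two_good (H : Hyp G p) (P : Sylow p G) :
    {E : Subgroup G | Good p E ∧ E ≤ P}.ncard = 2 := by
  classical
  have hp : p.Prime := Fact.out
  have := Fintype.ofFinite G
  have : Fintype (Sylow p G) := Fintype.ofFinite _
  have : Fintype (Subgroup G) := Fintype.ofFinite _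
  set S : Finset (Subgroup G) := {E | Good p E ∧ E ≤ P} with hS
  have hS' : {E : Subgroup G | Good p E ∧ E ≤ P}.ncard = S.card := by
    rw [← Set.ncard_coe_finset]; congr 1; ext; simp [hS]
  rw [hS']
  -- bound
  have hub : S.card ≤ p + 1 := by
    set f : Subgroup G → Finset G := fun E => {x | x ∈ E ∧ x ∉ Zc (P : Subgroup G)} with hf
    have hfc : ∀ E ∈ S, (f E).card = p ^ 2 - p := by
      intro E hE
      simp only [hS, Finset.mem_filter, Finset.mem_univ, true_and] at hE
      have := sub_sdiff_card E (Zc (P : Subgroup G)) (H.Zc_le_sq hE.1.1 hE.2)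
      rw [H.card_Zc, hE.1.1] at this
      rw [← Set.ncard_coe_finset]
      have h2 : ((f E : Finset G) : Set G) = (E : Set G) \ (Zc (P : Subgroup G) : Set G) := by
        ext; simp [hf]
      rw [h2]; omega
    have hdis : (S.biUnion f).card = S.card * (p ^ 2 - p) := by
      rw [Finset.card_biUnion]
      · rw [Finset.sum_congr rfl hfc]; simp
      · intro A hA B hB hAB
        refine Finset.disjoint_left.2 ?_
        intro x hx hx'
        simp only [hf, hS, Finset.mem_coe, Finset.mem_filter, Finset.mem_univ, true_and] at hx hx' hA hB
        apply hx.2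
        rw [← H.inf_eq_Zc hA.1.1 hB.1.1 hA.2 hB.2 hAB]
        exact ⟨hx.1, hx'.1⟩
    set T : Finset G := {x | x ∈ (P : Subgroup G) ∧ x ∉ Zc (P : Subgroup G)} with hT
    have hTc : T.card = p ^ 3 - p := by
      have := sub_sdiff_card (P : Subgroup G) (Zc (P : Subgroup G)) (Zc_le _)
      rw [H.card_Zc, H.card] at this
      rw [← Set.ncard_coe_finset]
      have h2 : (T : Set G) = ((P : Subgroup G) : Set G) \ (Zc (P : Subgroup G) : Set G) := by
        ext; simp [hT]; exact fun _ => Iff.rfl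
      rw [h2]; omega
    have hsub : S.biUnion f ⊆ T := by
      intro x hx
      simp only [hf, hS, hT, Finset.mem_biUnion, Finset.mem_filter, Finset.mem_univ, true_and] at hx ⊢
      obtain ⟨R, hR, hx, hx1⟩ := hx
      exact ⟨hR.2 hx, hx1⟩
    have hle := Finset.card_le_card hsub
    rw [hdis, hTc] at hle
    have e1 : p ^ 3 - p = (p + 1) * (p ^ 2 - p) := by
      have h1 : p ≤ p ^ 2 := Nat.le_self_pow (by norm_num) p
      have h2 : p ≤ p ^ 3 := Nat.le_self_pow (by norm_num) p
      zify [h1, h2]; ring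
    rw [e1] at hle
    apply Nat.le_of_mul_le_mul_right hle
    have := hp.two_le
    have : p < p ^ 2 := by nlinarith
    omega
  -- count
  set B : Finset (Sylow p G) := {Q | Q ≠ P ∧ Nat.card ((P : Subgroup G) ⊓ Q : Subgroup G) = p ^ 2} with hB
  set A : Finset (Sylow p G) := {Q | Nat.card ((P : Subgroup G) ⊓ Q : Subgroup G) ∣ p} with hA
  have hBc : B.card = S.card * p := by
    have : B = S.biUnion fun E => {Q : Sylow p G | Q ≠ P ∧ E ≤ Q} := by
      ext Q
      simp only [hB, hS, Finset.mem_biUnion, Finset.mem_filter, Finset.mem_univ, true_and]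
      constructor
      · rintro ⟨h1, h2⟩
        exact ⟨_, ⟨⟨h2, P, Q, h1.symm, inf_le_left, inf_le_right⟩, inf_le_left⟩, h1, inf_le_right⟩
      · rintro ⟨E, ⟨hE, hEP⟩, h1, hEQ⟩
        refine ⟨h1, ?_⟩
        rw [← H.eq_inf hE.1 h1.symm hEP hEQ, hE.1]
    rw [this, Finset.card_biUnion]
    · rw [Finset.sum_const_nat (m := p)]
      intro E hE
      simp only [hS, Finset.mem_filter, Finset.mem_univ, true_and] at hE
      have h1 := H.Good_card hE.1
      have h2 : {Q : Sylow p G | E ≤ Q} = insert P {Q : Sylow p G | Q ≠ P ∧ E ≤ Q} := by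
        ext Q
        simp only [Set.mem_setOf_eq, Set.mem_insert_iff]
        by_cases h : Q = P
        · subst h; simp [hE.2]
        · simp [h]
      rw [h2, Set.ncard_insert_of_notMem (by simp) (Set.toFinite _)] at h1
      rw [← Set.ncard_coe_finset]
      simpa using h1
    · intro E hE F hF hEF
      refine Finset.disjoint_left.2 ?_
      intro Q hQ hQ'
      simp only [hS, Finset.mem_coe, Finset.mem_filter, Finset.mem_univ, true_and] at hQ hQ' hE hF
      apply hEF
      rw [H.eq_inf hE.1.1 hQ.1.symm hE.2 hQ.2, H.eq_inf hF.1.1 hQ.1.symm hF.2 hQ'.2]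
  have hAc : p ^ 2 ∣ A.card := by
    apply dvd_card_of_orbit (K := (P : Subgroup G))
    · intro g Q hQ
      simp only [hA, Finset.mem_filter, Finset.mem_univ, true_and] at hQ ⊢
      rw [card_inf_smul]; exact hQ
    · intro Q hQ
      simp only [hA, Finset.mem_filter, Finset.mem_univ, true_and] at hQ
      obtain ⟨c, hc⟩ := hQ
      have := orbit_card P Q
      rw [H.card] at this
      refine ⟨c, ?_⟩
      have h0 : 0 < Nat.card ((P : Subgroup G) ⊓ Q : Subgroup G) := Nat.card_pos
      apply Nat.eq_of_mul_eq_mul_right h0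
      rw [this, mul_assoc, mul_comm c, ← hc]; ring
  have hBA : Disjoint B A := by
    refine Finset.disjoint_left.2 ?_
    intro Q h1 h2
    simp only [hA, hB, Finset.mem_filter, Finset.mem_univ, true_and] at h1 h2
    rw [h1.2] at h2
    have := Nat.le_of_dvd hp.pos h2
    nlinarith [hp.two_le]
  have hPn : P ∉ B ∪ A := by
    simp only [hA, hB, Finset.mem_union, Finset.mem_filter, Finset.mem_univ, true_and]
    rw [inf_idem, H.card]
    rintro (h | h)
    · exact h.1 rfl
    · have := Nat.le_of_dvd hp.pos h
      nlinarith [hp.two_le, pow_pos hp.pos 2, (by ring : p ^ 3 = p * p ^ 2)]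
  have hall : insert P (B ∪ A) = Finset.univ := by
    ext Q
    simp only [hA, hB, Finset.mem_insert, Finset.mem_union, Finset.mem_filter, Finset.mem_univ, true_and, iff_true]
    by_cases h : Q = P
    · exact Or.inl h
    right
    have d1 := Subgroup.card_dvd_of_le (inf_le_left : (P : Subgroup G) ⊓ Q ≤ P)
    rw [H.card] at d1
    obtain ⟨k, hk, hk'⟩ := (Nat.dvd_prime_pow hp).1 d1
    rw [hk']
    interval_cases k
    · right; simp
    · right; simp
    · left; exact ⟨h, rfl⟩
    · exfalso
      have h2 := sub_eq_of_card (inf_le_left : (P : Subgroup G) ⊓ Q ≤ P) (by rw [hk', H.card])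
      exact h (Sylow_eq_of_le (inf_eq_left.1 h2)).symm
  have hcnt := congrArg Finset.card hall
  rw [Finset.card_insert_of_notMem hPn, Finset.card_union_of_disjoint hBA, Finset.card_univ,
    ← Nat.card_eq_fintype_card, H.nS, hBc] at hcnt
  obtain ⟨k, hk⟩ := hAc
  rw [hk] at hcnt
  have h3 := H.hp3
  have e : p * (S.card + p * k) = p * (p ^ 2 + 2 * p + 2) := by
    have : p * (S.card + p * k) + 1 = p * (p ^ 2 + 2 * p + 2) + 1 := by
      linear_combination hcnt
    omega
  have e2 := Nat.eq_of_mul_eq_mul_left hp.pos e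
  have e3 : S.card % p = 2 % p := by
    have : (S.card + p * k) % p = (2 + p * (p + 2)) % p := by rw [e2]; congr 1; ring
    simpa [Nat.add_mul_mod_self_left] using this
  rw [Nat.mod_eq_of_lt (by omega : 2 < p)] at e3
  rcases lt_trichotomy S.card p with h | h | h
  · rwa [Nat.mod_eq_of_lt h] at e3
  · rw [h, Nat.mod_self] at e3; omega
  · have : S.card = p + 1 := by omega
    rw [this, Nat.add_mod_left, Nat.mod_eq_of_lt (by omega)] at e3
    omega

end OD

namespace OD

theorem two_conj {K : Type*} [Group K] [Finite K] (h4 : ¬ 4 ∣ Nat.card K) {a b : K} (ha : a ≠ 1)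
    (hb : b ≠ 1) {i j : ℕ} (hai : a ^ 2 ^ i = 1) (hbj : b ^ 2 ^ j = 1) :
    ∃ m : K, m * a * m⁻¹ = b := by
  have key : ∀ c : K, c ≠ 1 → ∀ i : ℕ, c ^ 2 ^ i = 1 → ∃ S : Sylow 2 K, c ∈ (S : Subgroup K) ∧
      ∀ x ∈ (S : Subgroup K), x ≠ 1 → x = c := by
    intro c hc i hi
    have hpg : IsPGroup 2 (Subgroup.zpowers c) := by
      have : orderOf c ∣ 2 ^ i := orderOf_dvd_of_pow_eq_one hi
      obtain ⟨k, -, hk⟩ := (Nat.dvd_prime_pow Nat.prime_two).1 this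
      exact IsPGroup.of_card (n := k) (by rw [Nat.card_zpowers, hk])
    obtain ⟨S, hS⟩ := hpg.exists_le_sylow
    have hcS : c ∈ (S : Subgroup K) := hS (Subgroup.mem_zpowers c)
    obtain ⟨n, hn⟩ := IsPGroup.iff_card.1 S.isPGroup'
    have hd : 2 ^ n ∣ Nat.card K := hn ▸ Subgroup.card_subgroup_dvd_card (S : Subgroup K)
    have hn2 : n < 2 := by
      by_contra hlt
      exact h4 ((pow_dvd_pow 2 (not_lt.1 hlt)).trans hd)
    have hcard : Nat.card (S : Subgroup K) ≤ 2 := by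
      rw [hn]; interval_cases n <;> norm_num
    refine ⟨S, hcS, fun x hx hx1 => ?_⟩
    by_contra hxc
    have : ({1, c, x} : Set K) ⊆ ((S : Subgroup K) : Set K) := by
      rintro y (rfl | rfl | rfl)
      · exact (S : Subgroup K).one_mem
      · exact hcS
      · exact hx
    have h2 := Set.ncard_le_ncard this (Set.toFinite _)
    rw [Set.ncard_eq_three.2 ⟨1, c, x, hc.symm, hx1.symm, Ne.symm hxc, rfl⟩] at h2
    have : 3 ≤ Nat.card (S : Subgroup K) := h2
    omega
  obtain ⟨S, haS, -⟩ := key a ha i hai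
  obtain ⟨T, hbT, hT⟩ := key b hb j hbj
  obtain ⟨m, hm⟩ := MulAction.exists_smul_eq K S T
  refine ⟨m, hT _ ?_ ?_⟩
  · rw [← hm, mem_smul]; simpa [mul_assoc] using haS
  · intro h; exact ha (conj_eq_one_iff.1 h)

variable {G : Type*} [Group G] [Finite G] {p : ℕ} [Fact p.Prime]

theorem conj_pow_odd {z x : G} (h : z * x * z⁻¹ = x⁻¹) (j : ℕ) :
    z ^ (2 * j + 1) * x * (z ^ (2 * j + 1))⁻¹ = x⁻¹ := by
  induction j with
  | zero => simpa using h
  | succ j ih =>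
    have h' : z * x⁻¹ * z⁻¹ = x := by
      have := congrArg (·⁻¹) h
      simpa [mul_assoc] using this
    calc z ^ (2 * (j + 1) + 1) * x * (z ^ (2 * (j + 1) + 1))⁻¹
        = z * (z * (z ^ (2 * j + 1) * x * (z ^ (2 * j + 1))⁻¹) * z⁻¹) * z⁻¹ := by
          rw [show 2 * (j + 1) + 1 = 1 + 1 + (2 * j + 1) by ring, pow_add, pow_add]; group
      _ = _ := by rw [ih, h', h]

theorem exists_mem_not {E F : Subgroup G} (h : Nat.card E < Nat.card F) : ∃ u ∈ F, u ∉ E := by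
  by_contra hcon
  push Not at hcon
  exact absurd (Subgroup.card_le_of_le (fun x hx => hcon x hx : F ≤ E)) (not_le.2 h)

/-- the inverting element -/
theorem Hyp.exists_inv (H : Hyp G p) {E : Subgroup G} (hE : Good p E) {P : Sylow p G}
    (hEP : E ≤ P) : ∃ z : G, z • P = P ∧ (∀ x ∈ E, z * x * z⁻¹ = x⁻¹) ∧ ∃ k : ℕ, z ^ 2 ^ k = 1 := by
  have hp : p.Prime := Fact.out
  obtain ⟨Q, hQP, hEQ⟩ : ∃ Q : Sylow p G, Q ≠ P ∧ E ≤ Q := by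
    obtain ⟨hc, A, B, hAB, hA, hB⟩ := hE
    by_cases h : A = P
    · exact ⟨B, fun h' => hAB (h.trans h'.symm), hB⟩
    · exact ⟨A, h, hA⟩
  have hc := hE.1
  have hinf := H.eq_inf hc hQP.symm hEP hEQ
  have hlt : p ^ 2 < p ^ 3 := Nat.pow_lt_pow_right hp.one_lt (by norm_num)
  obtain ⟨e', he', he'1⟩ := H.exists_Zc Q
  have he'E := H.Zc_le_sq hc hEQ he'
  obtain ⟨u, huP, huE⟩ := exists_mem_not (E := E) (F := P) (by rw [hc, H.card]; exact hlt)
  obtain ⟨v0, hvQ, hvE⟩ := exists_mem_not (E := E) (F := Q) (by rw [hc, H.card]; exact hlt)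
  obtain ⟨e, he_def⟩ : ∃ e, e = u * e' * u⁻¹ * e'⁻¹ := ⟨_, rfl⟩
  have heZ : e ∈ Zc (P : Subgroup G) := he_def ▸ H.comm_mem P huP (hEP he'E)
  have he1 : e ≠ 1 := by
    intro h
    apply huE
    rw [hinf]
    refine Subgroup.mem_inf.2 ⟨huP, ?_⟩
    refine H.mem_of_comm he' he'1 huP ?_
    have h2 : u * e' * u⁻¹ * e'⁻¹ = 1 := he_def ▸ h
    have h3 : u * e' = e' * u := by
      have := congrArg (· * e' * u) h2
      simpa [mul_assoc] using this
    exact h3.symm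
  have heE := H.Zc_le_sq hc hEP heZ
  obtain ⟨c, hc_def⟩ : ∃ c, c = v0 * e * v0⁻¹ * e⁻¹ := ⟨_, rfl⟩
  have hcZ : c ∈ Zc (Q : Subgroup G) := hc_def ▸ H.comm_mem Q hvQ (hEQ heE)
  have hc1 : c ≠ 1 := by
    intro h
    apply hvE
    rw [hinf]
    refine Subgroup.mem_inf.2 ⟨?_, hvQ⟩
    refine H.mem_of_comm heZ he1 hvQ ?_
    have h2 : v0 * e * v0⁻¹ * e⁻¹ = 1 := hc_def ▸ h
    have h3 : v0 * e = e * v0 := by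
      have := congrArg (· * e * v0) h2
      simpa [mul_assoc] using this
    exact h3.symm
  obtain ⟨k, hk⟩ : ∃ k : ℕ, c ^ k = e'⁻¹ := by
    have h1 : (⟨e', he'⟩ : Zc (Q : Subgroup G))⁻¹ ∈ Submonoid.powers (⟨c, hcZ⟩ : Zc (Q : Subgroup G)) := by
      apply mem_powers_of_prime_card (p := p) (H.card_Zc Q)
      intro h; exact hc1 (congrArg Subtype.val h)
    obtain ⟨k, hk⟩ := h1
    exact ⟨k, congrArg Subtype.val hk⟩
  have hve : v0 ^ k * e * (v0 ^ k)⁻¹ = c ^ k * e := by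
    have hcv : v0 * c = c * v0 := (mem_Zc.1 hcZ).2 v0 hvQ
    have h0 : v0 * e * v0⁻¹ = c * e := by rw [hc_def]; group
    clear hk
    induction k with
    | zero => simp
    | succ k ih =>
      have hcv' : v0 * c ^ k = c ^ k * v0 := (Commute.pow_right (show Commute v0 c from hcv) k)
      calc v0 ^ (k + 1) * e * (v0 ^ (k + 1))⁻¹ = v0 * (v0 ^ k * e * (v0 ^ k)⁻¹) * v0⁻¹ := by
            rw [pow_succ']; group
        _ = (v0 * c ^ k) * e * v0⁻¹ := by rw [ih]; group
        _ = c ^ k * (v0 * e * v0⁻¹) := by rw [hcv']; group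
        _ = _ := by rw [h0, pow_succ]; group
  obtain ⟨v, hv_def⟩ : ∃ v, v = v0 ^ k := ⟨_, rfl⟩
  rw [← hv_def, hk] at hve
  have hvQ' : v ∈ (Q : Subgroup G) := hv_def ▸ (Q : Subgroup G).pow_mem hvQ k
  have hve' : v * e' * v⁻¹ = e' := by
    rw [(mem_Zc.1 he').2 v hvQ']; group
  have hue : u * e * u⁻¹ = e := by
    rw [(mem_Zc.1 heZ).2 u huP]; group
  have hue' : u * e' * u⁻¹ = e * e' := by rw [he_def]; group
  have hee : e * e' = e' * e := comm_of_card_sq hc heE he'E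
  have cj : ∀ g a b : G, g * (a * b) * g⁻¹ = (g * a * g⁻¹) * (g * b * g⁻¹) := by intros; group
  have cji : ∀ g a : G, g * a⁻¹ * g⁻¹ = (g * a * g⁻¹)⁻¹ := by intros; group
  have w1 : (u * v * u) * e' * (u * v * u)⁻¹ = e := by
    calc _ = u * (v * (u * e' * u⁻¹) * v⁻¹) * u⁻¹ := by group
      _ = e := by rw [hue', cj v, hve, hve', mul_assoc e'⁻¹, hee, inv_mul_cancel_left, hue]
  have w2 : (u * v * u) * e * (u * v * u)⁻¹ = e'⁻¹ := by
    calc _ = u * (v * (u * e * u⁻¹) * v⁻¹) * u⁻¹ := by group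
      _ = e'⁻¹ := by rw [hue, hve, cj u, cji, hue', hue]; group
  obtain ⟨w, hw⟩ : ∃ w, w = u * v * u := ⟨_, rfl⟩
  rw [← hw] at w1 w2
  have z1 : (w * w) * e * (w * w)⁻¹ = e⁻¹ := by
    calc _ = w * (w * e * w⁻¹) * w⁻¹ := by group
      _ = _ := by rw [w2, cji, w1]
  have z2 : (w * w) * e' * (w * w)⁻¹ = e'⁻¹ := by
    calc _ = w * (w * e' * w⁻¹) * w⁻¹ := by group
      _ = _ := by rw [w1, w2]
  obtain ⟨n, m, ⟨j, rfl⟩, hord⟩ := Nat.exists_eq_two_pow_mul_odd (n := orderOf (w * w)) (orderOf_pos _).ne'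
  have z1' := conj_pow_odd z1 j
  have z2' := conj_pow_odd z2 j
  obtain ⟨z, hz⟩ : ∃ z, z = (w * w) ^ (2 * j + 1) := ⟨_, rfl⟩
  rw [← hz] at z1' z2'
  refine ⟨z, H.smul_eq_of heZ he1 (by rw [z1']; exact Subgroup.inv_mem _ heZ), ?_, n, ?_⟩
  · let K : Subgroup G :=
      { carrier := {x | x ∈ E ∧ z * x * z⁻¹ = x⁻¹}
        one_mem' := ⟨E.one_mem, by group⟩
        mul_mem' := by
          rintro a b ⟨ha, ha'⟩ ⟨hb, hb'⟩
          refine ⟨E.mul_mem ha hb, ?_⟩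
          rw [cj, ha', hb', ← mul_inv_rev, comm_of_card_sq hc hb ha]
        inv_mem' := by
          rintro a ⟨ha, ha'⟩
          exact ⟨E.inv_mem ha, by rw [cji, ha']⟩ }
    have hKE : K ≤ E := fun x hx => hx.1
    have heK : e ∈ K := ⟨heE, z1'⟩
    have he'K : e' ∈ K := ⟨he'E, z2'⟩
    have hKeq : K = E := by
      have d1 := Subgroup.card_dvd_of_le hKE
      rw [hc] at d1
      obtain ⟨i, hi, hi'⟩ := (Nat.dvd_prime_pow hp).1 d1
      by_cases hi2 : i = 2
      · exact sub_eq_of_card hKE (by rw [hi', hc, hi2])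
      · exfalso
        have hZK : Zc (P : Subgroup G) ≤ K := by
          intro x hx
          have h1 : (⟨x, hx⟩ : Zc (P : Subgroup G)) ∈ Submonoid.powers (⟨e, heZ⟩ : Zc (P : Subgroup G)) := by
            apply mem_powers_of_prime_card (p := p) (H.card_Zc P)
            intro h; exact he1 (congrArg Subtype.val h)
          obtain ⟨k, hk⟩ := h1
          have : e ^ k = x := congrArg Subtype.val hk
          rw [← this]; exact K.pow_mem heK k
        have : Zc (P : Subgroup G) = K := by
          apply sub_eq_of_card hZK
          rw [hi', H.card_Zc]
          exact (Nat.pow_le_pow_right hp.pos (by omega : i ≤ 1)).trans (by simp)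
        rw [← this] at he'K
        exact hQP (H.Zc_disj he' he'K he'1)
    intro x hx
    rw [← hKeq] at hx
    exact hx.2
  · rw [hz, ← pow_mul, mul_comm, ← hord, pow_orderOf_eq_one]

theorem Hyp.inv_triv (H : Hyp G p) {E : Subgroup G} (hE : Good p E) {P : Sylow p G}
    (hEP : E ≤ P) {z : G} (hz : z • P = P) (hinv : ∀ x ∈ E, z * x * z⁻¹ = x⁻¹) {f : G}
    (hf : f ∈ (P : Subgroup G)) : z * f * z⁻¹ * f⁻¹ ∈ E := by
  have hzf : z * f * z⁻¹ ∈ (P : Subgroup G) := by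
    rw [← hz, mem_smul]; simpa [mul_assoc] using hf
  apply H.cent_sq hE.1 hEP ((P : Subgroup G).mul_mem hzf ((P : Subgroup G).inv_mem hf))
  intro x hx
  have h1 : f⁻¹ * x * f ∈ E := by
    simpa using H.conj_mem_sq hE.1 hEP ((P : Subgroup G).inv_mem hf) hx
  have h2 : z⁻¹ * (f⁻¹ * x * f) * z = (f⁻¹ * x * f)⁻¹ := by
    have := hinv _ (E.inv_mem h1)
    rw [inv_inv] at this
    calc z⁻¹ * (f⁻¹ * x * f) * z = z⁻¹ * (z * (f⁻¹ * x * f)⁻¹ * z⁻¹) * z := by rw [this]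
      _ = _ := by group
  have h3 := hinv _ (E.inv_mem hx)
  rw [inv_inv] at h3
  have : z * f * z⁻¹ * f⁻¹ * x = x * (z * f * z⁻¹ * f⁻¹) := by
    calc z * f * z⁻¹ * f⁻¹ * x = z * (f * (z⁻¹ * (f⁻¹ * x * f) * z) * f⁻¹) * z⁻¹ * (z * f * z⁻¹ * f⁻¹) := by group
      _ = z * x⁻¹ * z⁻¹ * (z * f * z⁻¹ * f⁻¹) := by rw [h2]; group
      _ = _ := by rw [h3]
  exact this.symm

/-- the two good subgroups of a Sylow subgroup -/
theorem Hyp.good_cases (H : Hyp G p) {P : Sylow p G} {E F : Subgroup G} (hE : Good p E) (hEP : E ≤ P)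
    (hF : Good p F) (hFP : F ≤ P) (hne : E ≠ F) {X : Subgroup G} (hX : Good p X) (hXP : X ≤ P) :
    X = E ∨ X = F := by
  obtain ⟨A, B, hAB, hS⟩ := Set.ncard_eq_two.1 (H.two_good P)
  have h1 : E ∈ ({A, B} : Set (Subgroup G)) := hS ▸ ⟨hE, hEP⟩
  have h2 : F ∈ ({A, B} : Set (Subgroup G)) := hS ▸ ⟨hF, hFP⟩
  have h3 : X ∈ ({A, B} : Set (Subgroup G)) := hS ▸ ⟨hX, hXP⟩
  simp only [Set.mem_insert_iff, Set.mem_singleton_iff] at h1 h2 h3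
  rcases h1 with rfl | rfl <;> rcases h2 with rfl | rfl <;> rcases h3 with rfl | rfl <;> simp_all

theorem Good.conj {E : Subgroup G} (hE : Good p E) (g : G) : Good p (MulAut.conj g • E) := by
  obtain ⟨hc, A, B, hAB, hA, hB⟩ := hE
  refine ⟨by rw [card_conj, hc], g • A, g • B, ?_, ?_, ?_⟩
  · intro h; exact hAB (smul_left_cancel g h)
  · rw [coe_smul]; exact Subgroup.pointwise_smul_le_pointwise_smul_iff.2 hA
  · rw [coe_smul]; exact Subgroup.pointwise_smul_le_pointwise_smul_iff.2 hB

/-- L6 -/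
theorem Hyp.no_swap (H : Hyp G p) {P : Sylow p G} {E F : Subgroup G} (hE : Good p E) (hEP : E ≤ P)
    (hF : Good p F) (hFP : F ≤ P) (hne : E ≠ F) {g : G} (hg : g • P = P) :
    MulAut.conj g • E ≠ F := by
  intro hsw
  have hp : p.Prime := Fact.out
  have h3 := H.hp3
  have hpodd : ¬ 2 ∣ p := by
    intro h
    have := (Nat.prime_dvd_prime_iff_eq Nat.prime_two hp).1 h
    omega
  have hconjP : ∀ n : G, n • P = P → ∀ X : Subgroup G, X ≤ P → MulAut.conj n • X ≤ P := by
    intro n hn X hX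
    have : ((n • P : Sylow p G) : Subgroup G) = P := by rw [hn]
    rw [coe_smul] at this
    rw [← this]
    exact Subgroup.pointwise_smul_le_pointwise_smul_iff.2 hX
  have mul_conj : ∀ (a b : G) (X : Subgroup G), MulAut.conj (a * b) • X = MulAut.conj a • MulAut.conj b • X := by
    intro a b X; rw [map_mul, mul_smul]
  -- behaviour on the pair
  have hEE : ∀ n : G, n • P = P → (MulAut.conj n • E = E ∧ MulAut.conj n • F = F) ∨
      (MulAut.conj n • E = F ∧ MulAut.conj n • F = E) := by
    intro n hn
    have h1 := H.good_cases hE hEP hF hFP hne (hE.conj n) (hconjP n hn E hEP)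
    have h2 := H.good_cases hE hEP hF hFP hne (hF.conj n) (hconjP n hn F hFP)
    have h4 : MulAut.conj n • E ≠ MulAut.conj n • F := fun h => hne (smul_left_cancel _ h)
    rcases h1 with h1 | h1 <;> rcases h2 with h2 | h2
    · exact absurd (h1.trans h2.symm) h4
    · exact Or.inl ⟨h1, h2⟩
    · exact Or.inr ⟨h1, h2⟩
    · exact absurd (h1.trans h2.symm) h4
  let N : Subgroup G := Subgroup.normalizer (P : Set G)
  have memN : ∀ n : G, n ∈ N ↔ n • P = P := fun n => Sylow.smul_eq_iff_mem_normalizer.symm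
  let M : Subgroup N :=
    { carrier := {n | MulAut.conj (n : G) • E = E}
      one_mem' := by simp
      mul_mem' := by
        intro a b ha hb
        change MulAut.conj ((a : G) * b) • E = E
        rw [mul_conj, hb, ha]
      inv_mem' := by
        intro a ha
        change MulAut.conj ((a : G)⁻¹) • E = E
        rw [map_inv, inv_smul_eq_iff]; exact ha.symm }
  have memM : ∀ n : N, n ∈ M ↔ MulAut.conj (n : G) • E = E := fun n => Iff.rfl
  have hidx : M.index = 2 := by
    rw [Subgroup.index_eq_two_iff]
    refine ⟨⟨g, (memN g).2 hg⟩, fun b => ?_⟩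
    rw [memM, memM]
    change Xor' (MulAut.conj ((b : G) * g) • E = E) _
    rw [mul_conj, hsw]
    rcases hEE b ((memN _).1 b.2) with ⟨h1, h2⟩ | ⟨h1, h2⟩
    · rw [h1, h2]; right; exact ⟨rfl, hne.symm⟩
    · rw [h1, h2]; left; exact ⟨rfl, hne.symm⟩
  have h4 : ¬ 4 ∣ Nat.card M := by
    intro h
    apply H.h8 P
    have := Subgroup.card_mul_index M
    rw [hidx] at this
    change 8 ∣ Nat.card N
    rw [← this]
    exact mul_dvd_mul h (dvd_refl 2)
  obtain ⟨z1, hz1, hi1, k1, hk1⟩ := H.exists_inv hE hEP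
  obtain ⟨z2, hz2, hi2, k2, hk2⟩ := H.exists_inv hF hFP
  have fixF : ∀ n : G, n • P = P → MulAut.conj n • E = E → MulAut.conj n • F = F := by
    intro n hn h
    rcases hEE n hn with h' | h'
    · exact h'.2
    · exact absurd (h.symm.trans h'.1) hne
  have hz1E : MulAut.conj z1 • E = E := conj_eq_of_le fun e he => by
    rw [hi1 e he]; exact E.inv_mem he
  have hz2F : MulAut.conj z2 • F = F := conj_eq_of_le fun e he => by
    rw [hi2 e he]; exact F.inv_mem he
  have hz2E : MulAut.conj z2 • E = E := by
    rcases hEE z2 hz2 with h' | h'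
    · exact h'.1
    · exact absurd (h'.2.symm.trans hz2F) hne
  -- squares
  have hsq : ∀ X : Subgroup G, Good p X → ∀ x ∈ X, ∀ K : Subgroup G, x * x ∈ K → x ∈ K := by
    intro X hX x hx K hK
    have h1 := H.Good_exp hX hx
    obtain ⟨j, hj⟩ : ∃ j, p + 1 = 2 * j := ⟨(p + 1) / 2, by omega⟩
    have : x = (x * x) ^ j := by
      rw [← pow_two, ← pow_mul, ← hj, pow_succ, h1, one_mul]
    rw [this]; exact K.pow_mem hK j
  have hne1 : ∀ X : Subgroup G, Good p X → ∀ z : G, (∀ x ∈ X, z * x * z⁻¹ = x⁻¹) → z ≠ 1 := by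
    intro X hX z hz h1
    have hlt : Nat.card (⊥ : Subgroup G) < Nat.card X := by
      rw [hX.1, Subgroup.card_bot]; exact Nat.one_lt_pow (by norm_num) hp.one_lt
    obtain ⟨x, hx, hx1⟩ := exists_mem_not hlt
    apply hx1
    apply hsq X hX x hx
    have := hz x hx
    rw [h1] at this
    rw [Subgroup.mem_bot]
    simp only [one_mul, inv_one, mul_one] at this
    nth_rewrite 1 [this]; simp
  let a : M := ⟨⟨z1, (memN _).2 hz1⟩, hz1E⟩
  let b : M := ⟨⟨z2, (memN _).2 hz2⟩, hz2E⟩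
  obtain ⟨m, hm⟩ := two_conj (K := M) h4 (a := a) (b := b) (i := k1) (j := k2)
    (fun h => hne1 E hE z1 hi1 (congrArg (fun t : M => ((t : N) : G)) h))
    (fun h => hne1 F hF z2 hi2 (congrArg (fun t : M => ((t : N) : G)) h))
    (Subtype.ext (Subtype.ext hk1)) (Subtype.ext (Subtype.ext hk2))
  obtain ⟨m', hm'⟩ : ∃ m' : G, m' = ((m : N) : G) := ⟨_, rfl⟩
  have hmz : m' * z1 * m'⁻¹ = z2 := by
    rw [hm']; exact congrArg (fun t : M => ((t : N) : G)) hm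
  have hmP : m' • P = P := by rw [hm']; exact (memN _).1 (m : N).2
  have hmE : MulAut.conj m' • E = E := by rw [hm']; exact m.2
  have hmF := fixF m' hmP hmE
  have hlt : Nat.card (Zc (P : Subgroup G)) < Nat.card F := by
    rw [H.card_Zc, hF.1]; nlinarith
  obtain ⟨f, hfF, hfZ⟩ := exists_mem_not hlt
  apply hfZ
  apply hsq F hF f hfF
  have hf' : m'⁻¹ * f * m' ∈ F := by rw [← mem_conj, hmF]; exact hfF
  have ht : z1 * (m'⁻¹ * f * m') * z1⁻¹ * (m'⁻¹ * f * m')⁻¹ ∈ Zc (P : Subgroup G) := by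
    rw [← H.inf_eq_Zc hE.1 hF.1 hEP hFP hne]
    refine Subgroup.mem_inf.2 ⟨H.inv_triv hE hEP hz1 hi1 (hFP hf'), F.mul_mem ?_ (F.inv_mem hf')⟩
    rw [← fixF z1 hz1 hz1E, mem_conj]
    simpa [mul_assoc] using hf'
  have hZ : MulAut.conj m' • Zc (P : Subgroup G) = Zc (P : Subgroup G) := by
    rw [← Zc_conj, ← coe_smul, hmP]
  have h5 : z2 * f * z2⁻¹ * f⁻¹ ∈ Zc (P : Subgroup G) := by
    rw [← hZ, mem_conj, ← hmz]
    convert ht using 1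
    group
  rw [hi2 f hfF] at h5
  have := Subgroup.inv_mem _ h5
  simpa using this

end OD

namespace OD

/-- a projective plane with a group acting and with elation subgroups -/
structure Plane (G Pt Ln : Type*) [Group G] [MulAction G Pt] [MulAction G Ln] (p : ℕ)
    (I : Pt → Ln → Prop) (U : Ln → Subgroup G) : Prop where
  inv : ∀ (g : G) x l, I x l → I (g • x) (g • l)
  join : ∀ x y, x ≠ y → ∃ l, I x l ∧ I y l
  meet : ∀ l m, l ≠ m → ∃ x, I x l ∧ I x m
  uniq : ∀ x y l m, x ≠ y → I x l → I y l → I x m → I y m → l = m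
  ptsl : ∀ l, {x | I x l}.ncard = p + 1
  lnsx : ∀ x, {l | I x l}.ncard = p + 1
  fin : Finite Pt
  card : Nat.card Pt = p ^ 2 + p + 1
  Ucard : ∀ l, Nat.card (U l) = p ^ 2
  Ucomm : ∀ l, ∀ a ∈ U l, ∀ b ∈ U l, a * b = b * a
  Uexp : ∀ l, ∀ a ∈ U l, a ^ p = 1
  Ufix : ∀ l x, I x l → ∀ u ∈ U l, u • x = x
  Ufree : ∀ l x, ¬ I x l → ∀ u ∈ U l, u • x = x → u = 1
  Utrans : ∀ l x y, ¬ I x l → ¬ I y l → ∃ u ∈ U l, u • x = y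
  Ucen : ∀ l, ∀ u ∈ U l, ∃ c, I c l ∧ ∀ m, I c m → u • m = m

/-- counting: a partial plane with the right numbers is a plane -/
theorem join_of_count {Pt Ln : Type*} [Finite Pt] [Finite Ln] (I : Pt → Ln → Prop) (p : ℕ)
    (uniq : ∀ x y l m, x ≠ y → I x l → I y l → I x m → I y m → l = m)
    (ptsl : ∀ l, {x | I x l}.ncard = p + 1) (lnsx : ∀ x, {l | I x l}.ncard = p + 1)
    (card : Nat.card Pt = p ^ 2 + p + 1) (x y : Pt) (hxy : x ≠ y) : ∃ l, I x l ∧ I y l := by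
  classical
  have := Fintype.ofFinite Pt
  have := Fintype.ofFinite Ln
  set S : Finset Ln := {l | I x l} with hS
  have hSc : S.card = p + 1 := by
    rw [← lnsx x, ← Set.ncard_coe_finset]; congr 1; ext; simp [hS]
  set f : Ln → Finset Pt := fun l => {y | y ≠ x ∧ I y l} with hf
  have hfc : ∀ l ∈ S, (f l).card = p := by
    intro l hl
    have h1 := ptsl l
    have h2 : {x | I x l} = insert x {y | y ≠ x ∧ I y l} := by
      ext y
      simp only [hS, Finset.mem_filter, Finset.mem_univ, true_and] at hl
      simp only [Set.mem_setOf_eq, Set.mem_insert_iff]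
      by_cases h : y = x
      · subst h; simp [hl]
      · simp [h]
    rw [h2, Set.ncard_insert_of_notMem (by simp) (Set.toFinite _)] at h1
    rw [← Set.ncard_coe_finset]
    simpa [hf] using h1
  have hu : (S.biUnion f).card = (p + 1) * p := by
    rw [Finset.card_biUnion, Finset.sum_const_nat hfc, hSc]
    intro l hl m hm hlm
    refine Finset.disjoint_left.2 fun z hz hz' => hlm ?_
    simp only [hS, hf, Finset.mem_coe, Finset.mem_filter, Finset.mem_univ, true_and] at hl hm hz hz'
    exact uniq z x l m hz.1 hz.2 hl hz'.2 hm
  have hsub : S.biUnion f ⊆ Finset.univ.erase x := by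
    intro z hz
    simp only [hf, Finset.mem_biUnion, Finset.mem_filter, Finset.mem_univ, true_and] at hz
    obtain ⟨l, -, h, -⟩ := hz
    simp [h]
  have heq : S.biUnion f = Finset.univ.erase x := by
    apply Finset.eq_of_subset_of_card_le hsub
    rw [Finset.card_erase_of_mem (Finset.mem_univ _), Finset.card_univ, ← Nat.card_eq_fintype_card,
      card, hu]
    apply le_of_eq
    have : p ^ 2 + p + 1 = (p + 1) * p + 1 := by ring
    omega
  have : y ∈ S.biUnion f := by rw [heq]; simp [hxy.symm]
  simp only [hS, hf, Finset.mem_biUnion, Finset.mem_filter, Finset.mem_univ, true_and] at this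
  obtain ⟨l, h1, -, h2⟩ := this
  exact ⟨l, h1, h2⟩

variable {G : Type*} [Group G] [Finite G] {p : ℕ} [Fact p.Prime]

structure Geo (p : ℕ) (A B : Subgroup G → Prop) : Prop where
  goodA : ∀ X, A X → Good p X
  goodB : ∀ X, B X → Good p X
  disj : ∀ X, A X → ¬ B X
  cases : ∀ X, Good p X → A X ∨ B X
  exA : ∀ Q : Sylow p G, ∃ X, A X ∧ X ≤ Q
  exB : ∀ Q : Sylow p G, ∃ X, B X ∧ X ≤ Q
  uA : ∀ (Q : Sylow p G) X X', A X → A X' → X ≤ Q → X' ≤ Q → X = X'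
  uB : ∀ (Q : Sylow p G) X X', B X → B X' → X ≤ Q → X' ≤ Q → X = X'
  cA : ∀ (g : G) X, A X → A (MulAut.conj g • X)
  cB : ∀ (g : G) X, B X → B (MulAut.conj g • X)

theorem Geo.symm {A B : Subgroup G → Prop} (K : Geo p A B) : Geo p B A :=
  ⟨K.goodB, K.goodA, fun X h h' => K.disj X h' h, fun X h => (K.cases X h).symm, K.exB, K.exA,
    K.uB, K.uA, K.cB, K.cA⟩

theorem mul_conj (a b : G) (X : Subgroup G) :
    MulAut.conj (a * b) • X = MulAut.conj a • MulAut.conj b • X := by rw [map_mul, mul_smul]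

theorem conj_le_smul {g : G} {X : Subgroup G} {Q : Sylow p G} (h : X ≤ Q) :
    MulAut.conj g • X ≤ ((g • Q : Sylow p G) : Subgroup G) := by
  rw [coe_smul]; exact Subgroup.pointwise_smul_le_pointwise_smul_iff.2 h

/-- conjugates of the two good subgroups are different -/
theorem Hyp.no_conj (H : Hyp G p) {P : Sylow p G} {E F : Subgroup G} (hE : Good p E) (hEP : E ≤ P)
    (hF : Good p F) (hFP : F ≤ P) (hne : E ≠ F) (k : G) : MulAut.conj k • E ≠ F := by
  intro hk
  let N : Subgroup G := Subgroup.normalizer (F : Set G)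
  have hN : ∀ Q : Sylow p G, F ≤ Q → (Q : Subgroup G) ≤ N := by
    intro Q hQ a ha
    rw [Subgroup.mem_normalizer_iff]
    intro x
    constructor
    · exact fun hx => H.conj_mem_sq hF.1 hQ ha hx
    · intro hx
      have := H.conj_mem_sq hF.1 hQ ((Q : Subgroup G).inv_mem ha) hx
      simpa [mul_assoc] using this
  have hFk : F ≤ ((k • P : Sylow p G) : Subgroup G) := by
    rw [← hk]; exact conj_le_smul hEP
  obtain ⟨n, hn⟩ := MulAction.exists_smul_eq N ((k • P).subtype (hN _ hFk)) (P.subtype (hN _ hFP))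
  simp_rw [Sylow.smul_subtype, Subgroup.smul_def, smul_smul] at hn
  have hn' := Sylow.subtype_injective hn
  apply H.no_swap hE hEP hF hFP hne hn'
  rw [mul_conj, hk]
  apply conj_eq_of_le
  intro e he
  exact ((Subgroup.mem_normalizer_iff.1 n.2) e).1 he

theorem Hyp.exists_geo (H : Hyp G p) : ∃ A B : Subgroup G → Prop, Geo p A B := by
  obtain ⟨P⟩ : Nonempty (Sylow p G) := inferInstance
  obtain ⟨E, F, hne, hS⟩ := Set.ncard_eq_two.1 (H.two_good P)
  obtain ⟨hE, hEP⟩ : E ∈ {E : Subgroup G | Good p E ∧ E ≤ P} := by rw [hS]; simp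
  obtain ⟨hF, hFP⟩ : F ∈ {E : Subgroup G | Good p E ∧ E ≤ P} := by rw [hS]; simp
  have hd : ∀ X, (∃ g : G, X = MulAut.conj g • E) → ¬ ∃ g : G, X = MulAut.conj g • F := by
    rintro X ⟨g, rfl⟩ ⟨h, hh⟩
    apply H.no_conj hE hEP hF hFP hne (h⁻¹ * g)
    rw [mul_conj, hh, map_inv, inv_smul_smul]
  have hcs : ∀ (Q : Sylow p G), ∃ g : G, MulAut.conj g • E ≤ Q ∧ MulAut.conj g • F ≤ Q ∧
      ∀ X, Good p X → X ≤ Q → X = MulAut.conj g • E ∨ X = MulAut.conj g • F := by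
    intro Q
    obtain ⟨g, rfl⟩ := MulAction.exists_smul_eq G P Q
    refine ⟨g, conj_le_smul hEP, conj_le_smul hFP, fun X hX hXQ => ?_⟩
    have : MulAut.conj g⁻¹ • X ≤ P := by
      have := conj_le_smul (g := g⁻¹) hXQ
      rwa [inv_smul_smul] at this
    have := H.good_cases hE hEP hF hFP hne (hX.conj g⁻¹) this
    simpa only [map_inv, inv_smul_eq_iff] using this
  refine ⟨fun X => ∃ g : G, X = MulAut.conj g • E, fun X => ∃ g : G, X = MulAut.conj g • F, ?_⟩
  constructor
  · rintro X ⟨g, rfl⟩; exact hE.conj g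
  · rintro X ⟨g, rfl⟩; exact hF.conj g
  · exact hd
  · intro X hX
    obtain ⟨Q, -, -, hQ, -⟩ := hX.2
    obtain ⟨g, -, -, h⟩ := hcs Q
    rcases h X hX hQ with h | h
    · exact Or.inl ⟨g, h⟩
    · exact Or.inr ⟨g, h⟩
  · intro Q
    obtain ⟨g, h, -, -⟩ := hcs Q
    exact ⟨_, ⟨g, rfl⟩, h⟩
  · intro Q
    obtain ⟨g, -, h, -⟩ := hcs Q
    exact ⟨_, ⟨g, rfl⟩, h⟩
  · have key : ∀ (Q : Sylow p G) X, (∃ g : G, X = MulAut.conj g • E) → X ≤ Q →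
        X = MulAut.conj (Classical.choose (hcs Q)) • E := by
      intro Q X hX hXQ
      have hs := Classical.choose_spec (hcs Q)
      rcases hs.2.2 X (by obtain ⟨g, rfl⟩ := hX; exact hE.conj g) hXQ with h | h
      · exact h
      · exact absurd ⟨_, h⟩ (hd X hX)
    intro Q X X' h h' hQ hQ'
    rw [key Q X h hQ, key Q X' h' hQ']
  · have key : ∀ (Q : Sylow p G) X, (∃ g : G, X = MulAut.conj g • F) → X ≤ Q →
        X = MulAut.conj (Classical.choose (hcs Q)) • F := by
      intro Q X hX hXQ
      have hs := Classical.choose_spec (hcs Q)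
      rcases hs.2.2 X (by obtain ⟨g, rfl⟩ := hX; exact hF.conj g) hXQ with h | h
      · exact absurd hX (hd X ⟨_, h⟩)
      · exact h
    intro Q X X' h h' hQ hQ'
    rw [key Q X h hQ, key Q X' h' hQ']
  · rintro g X ⟨h, rfl⟩
    exact ⟨g * h, (mul_conj _ _ _).symm⟩
  · rintro g X ⟨h, rfl⟩
    exact ⟨g * h, (mul_conj _ _ _).symm⟩

section
variable {A B : Subgroup G → Prop}

def Inc (p : ℕ) (X Y : Subgroup G) : Prop := ∃ Q : Sylow p G, X ≤ Q ∧ Y ≤ Q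

theorem Inc.symm {X Y : Subgroup G} (h : Inc p X Y) : Inc p Y X := by
  obtain ⟨Q, h1, h2⟩ := h
  exact ⟨Q, h2, h1⟩

theorem Geo.uQ (K : Geo p A B) (H : Hyp G p) {X Y : Subgroup G} (hX : A X) (hY : B Y)
    {Q Q' : Sylow p G} (h1 : X ≤ Q) (h2 : Y ≤ Q) (h3 : X ≤ Q') (h4 : Y ≤ Q') : Q = Q' := by
  by_contra hne
  have e1 := H.eq_inf (K.goodA X hX).1 hne h1 h3
  have e2 := H.eq_inf (K.goodB Y hY).1 hne h2 h4
  rw [← e1] at e2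
  exact K.disj X hX (e2 ▸ hY)

theorem Geo.norm (K : Geo p A B) (H : Hyp G p) {X Y : Subgroup G} (hX : A X)
    (hI : Inc p X Y) {y : G} (hy : y ∈ Y) : MulAut.conj y • X = X := by
  obtain ⟨Q, h1, h2⟩ := hI
  exact H.conj_sq (K.goodA X hX).1 h1 (h2 hy)

theorem Geo.inc_of_norm (K : Geo p A B) (H : Hyp G p) {X Y : Subgroup G} (hX : A X) (hY : B Y)
    {y : G} (hy : y ∈ Y) (hy1 : y ≠ 1) (hn : MulAut.conj y • X = X) : Inc p X Y := by
  have hp : p.Prime := Fact.out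
  obtain ⟨Q, hYQ, hyQ⟩ := H.Good_cover (K.goodB Y hY) hy hy1
  have hpX : IsPGroup p X := IsPGroup.of_card (K.goodA X hX).1
  have hpy : IsPGroup p (Subgroup.zpowers y) := by
    have : orderOf y ∣ p ^ 1 := by
      rw [pow_one]; exact orderOf_dvd_of_pow_eq_one (H.Good_exp (K.goodB Y hY) hy)
    obtain ⟨k, -, hk⟩ := (Nat.dvd_prime_pow hp).1 this
    exact IsPGroup.of_card (n := k) (by rw [Nat.card_zpowers, hk])
  have hle : Subgroup.zpowers y ≤ Subgroup.normalizer (X : Set G) := by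
    rw [Subgroup.zpowers_le, Subgroup.mem_normalizer_iff]
    intro x
    have : y * x * y⁻¹ ∈ X ↔ y * x * y⁻¹ ∈ MulAut.conj y • X := by rw [hn]
    rw [this, mem_conj]
    simp [mul_assoc]
  obtain ⟨P, hP⟩ := (hpX.to_sup_of_normal_left' hpy hle).exists_le_sylow
  have hXP : X ≤ P := le_sup_left.trans hP
  have hyP : y ∈ (P : Subgroup G) := hP ((le_sup_right : _ ≤ X ⊔ Subgroup.zpowers y) (Subgroup.mem_zpowers y))
  by_cases hPQ : P = Q
  · exact ⟨Q, hPQ ▸ hXP, hYQ⟩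
  have hZ : Zc (P : Subgroup G) ≤ (P : Subgroup G) ⊓ Q := by
    intro t ht
    refine Subgroup.mem_inf.2 ⟨Zc_le _ ht, ?_⟩
    exact H.mem_of_comm hyQ hy1 (Zc_le _ ht) ((mem_Zc.1 ht).2 y hyP)
  have hc : Nat.card ((P : Subgroup G) ⊓ Q : Subgroup G) = p ^ 2 := by
    have d1 := Subgroup.card_dvd_of_le (inf_le_left : (P : Subgroup G) ⊓ Q ≤ P)
    rw [H.card] at d1
    obtain ⟨k, hk, hk'⟩ := (Nat.dvd_prime_pow hp).1 d1
    have hk1 : ¬ k ≤ 1 := by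
      intro h
      have := sub_eq_of_card hZ (by
        rw [hk', H.card_Zc]; exact (Nat.pow_le_pow_right hp.pos h).trans (by simp))
      apply hPQ
      refine H.Zc_disj (x := y) ?_ hyQ hy1
      rw [this]
      exact Subgroup.mem_inf.2 ⟨hyP, Zc_le _ hyQ⟩
    have hk3 : k ≠ 3 := by
      rintro rfl
      have h2 := sub_eq_of_card (inf_le_left : (P : Subgroup G) ⊓ Q ≤ P) (by rw [hk', H.card])
      exact hPQ (Sylow_eq_of_le (inf_eq_left.1 h2))
    have : k = 2 := by omega
    rw [hk', this]
  have hF : Good p ((P : Subgroup G) ⊓ Q : Subgroup G) := ⟨hc, P, Q, hPQ, inf_le_left, inf_le_right⟩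
  rcases K.cases _ hF with h | h
  · have := K.uA P X _ hX h hXP inf_le_left
    exact ⟨Q, this ▸ inf_le_right, hYQ⟩
  · have := K.uB Q Y _ hY h hYQ inf_le_right
    exact ⟨P, hXP, this ▸ inf_le_left⟩

theorem Geo.uniq (K : Geo p A B) (H : Hyp G p) {X1 X2 Y Y' : Subgroup G} (hX1 : A X1) (hX2 : A X2)
    (hY : B Y) (hY' : B Y') (hne : X1 ≠ X2) (h1 : Inc p X1 Y) (h2 : Inc p X2 Y)
    (h3 : Inc p X1 Y') (h4 : Inc p X2 Y') : Y = Y' := by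
  by_contra hYY
  obtain ⟨Q, hQ1, hQ2⟩ := id h1
  obtain ⟨R, hR1, hR2⟩ := id h2
  obtain ⟨Q', hQ'1, hQ'2⟩ := id h3
  obtain ⟨y, hyZ, hy1⟩ := H.exists_Zc R
  have hyX2 := H.Zc_le_sq (K.goodA _ hX2).1 hR1 hyZ
  have hyY := H.Zc_le_sq (K.goodB _ hY).1 hR2 hyZ
  have n1 := K.norm H hX1 h1 hyY
  have n2 := K.symm.norm H hY' h4.symm hyX2
  have hyQ' : y • Q' = Q' := by
    apply K.uQ H hX1 hY' _ _ hQ'1 hQ'2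
    · rw [← n1]; exact conj_le_smul hQ'1
    · rw [← n2]; exact conj_le_smul hQ'2
  have hyQ'' : y ∈ (R : Subgroup G) ⊓ Q' := by
    rw [← IsPGroup.inf_normalizer_sylow R.isPGroup' Q']
    exact Subgroup.mem_inf.2 ⟨Zc_le _ hyZ, Sylow.smul_eq_iff_mem_normalizer.1 hyQ'⟩
  have hQQ : Q ≠ Q' := by
    rintro rfl
    exact hYY (K.uB Q _ _ hY hY' hQ2 hQ'2)
  have hyX1 : y ∈ X1 := by
    rw [H.eq_inf (K.goodA _ hX1).1 hQQ hQ1 hQ'1]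
    exact Subgroup.mem_inf.2 ⟨hQ2 hyY, (Subgroup.mem_inf.1 hyQ'').2⟩
  have hyZQ : y ∈ Zc (Q : Subgroup G) := by
    rw [← H.inf_eq_Zc (K.goodA _ hX1).1 (K.goodB _ hY).1 hQ1 hQ2 (fun h => K.disj _ hX1 (h ▸ hY))]
    exact Subgroup.mem_inf.2 ⟨hyX1, hyY⟩
  have : Q = R := H.Zc_disj hyZQ hyZ hy1
  subst this
  exact hne (K.uA Q _ _ hX1 hX2 hQ1 hR1)

theorem Geo.count (K : Geo p A B) (H : Hyp G p) {Y : Subgroup G} (hY : B Y) :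
    {X : {X // A X} | Inc p X.1 Y}.ncard = p + 1 := by
  rw [← H.Good_card (K.goodB Y hY)]
  symm
  apply Set.ncard_congr (fun Q _ => (⟨Classical.choose (K.exA Q), (Classical.choose_spec (K.exA Q)).1⟩ : {X // A X}))
  · intro Q hQ
    exact ⟨Q, (Classical.choose_spec (K.exA Q)).2, hQ⟩
  · intro Q R hQ hR h
    have h := congrArg Subtype.val h
    refine K.uQ H (Classical.choose_spec (K.exA Q)).1 hY (Classical.choose_spec (K.exA Q)).2 hQ ?_ hR
    change Classical.choose (K.exA Q) = Classical.choose (K.exA R) at h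
    rw [h]; exact (Classical.choose_spec (K.exA R)).2
  · rintro X ⟨Q, h1, h2⟩
    refine ⟨Q, h2, Subtype.ext ?_⟩
    exact K.uA Q _ _ (Classical.choose_spec (K.exA Q)).1 X.2 (Classical.choose_spec (K.exA Q)).2 h1

theorem Geo.card (K : Geo p A B) (H : Hyp G p) : Nat.card {X // A X} = p ^ 2 + p + 1 := by
  classical
  have : Fintype (Sylow p G) := Fintype.ofFinite _
  have : Fintype {X // A X} := Fintype.ofFinite _
  have h := Finset.card_eq_sum_card_fiberwise (s := (Finset.univ : Finset (Sylow p G)))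
    (t := (Finset.univ : Finset {X // A X}))
    (f := fun Q => (⟨Classical.choose (K.exA Q), (Classical.choose_spec (K.exA Q)).1⟩ : {X // A X}))
    (by intro x _; simp)
  rw [Finset.sum_const_nat (m := p + 1), Finset.card_univ, Finset.card_univ, ← Nat.card_eq_fintype_card,
    ← Nat.card_eq_fintype_card, H.nS, mul_comm] at h
  · exact (Nat.eq_of_mul_eq_mul_right (by omega) h).symm
  · intro X _
    rw [← H.Good_card (K.goodA X.1 X.2), ← Set.ncard_coe_finset]
    congr 1
    ext Q
    simp only [Finset.coe_filter, Finset.mem_univ, true_and, Set.mem_setOf_eq]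
    constructor
    · rintro rfl; exact (Classical.choose_spec (K.exA Q)).2
    · intro h
      apply Subtype.ext
      exact K.uA Q _ _ (Classical.choose_spec (K.exA Q)).1 X.2 (Classical.choose_spec (K.exA Q)).2 h

/-- conjugation action -/
@[reducible] def conjAction (A : Subgroup G → Prop)
    (cA : ∀ (g : G) X, A X → A (MulAut.conj g • X)) : MulAction G {X // A X} where
  smul g X := ⟨MulAut.conj g • X.1, cA g X.1 X.2⟩
  one_smul X := Subtype.ext (by change MulAut.conj (1 : G) • X.1 = X.1; simp)
  mul_smul a b X := Subtype.ext (mul_conj a b X.1)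

theorem Geo.plane (K : Geo p A B) (H : Hyp G p) :
    let _ := conjAction A K.cA
    let _ := conjAction B K.cB
    Plane G {X // A X} {Y // B Y} p (fun X Y => Inc p X.1 Y.1) (fun Y => Y.1) := by
  let iA := conjAction A K.cA
  let iB := conjAction B K.cB
  have sA : ∀ (g : G) (X : {X // A X}), (g • X).1 = MulAut.conj g • X.1 := fun _ _ => rfl
  have sB : ∀ (g : G) (X : {X // B X}), (g • X).1 = MulAut.conj g • X.1 := fun _ _ => rfl
  have uq : ∀ (x y : {X // A X}) (l m : {Y // B Y}), x ≠ y → Inc p x.1 l.1 → Inc p y.1 l.1 →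
      Inc p x.1 m.1 → Inc p y.1 m.1 → l = m := by
    intro x y l m hxy h1 h2 h3 h4
    exact Subtype.ext (K.uniq H x.2 y.2 l.2 m.2 (fun h => hxy (Subtype.ext h)) h1 h2 h3 h4)
  have uq' : ∀ (l m : {Y // B Y}) (x y : {X // A X}), l ≠ m → Inc p x.1 l.1 → Inc p x.1 m.1 →
      Inc p y.1 l.1 → Inc p y.1 m.1 → x = y := by
    intro l m x y hlm h1 h2 h3 h4
    by_contra hxy
    exact hlm (uq x y l m hxy h1 h3 h2 h4)
  have hpl : ∀ l : {Y // B Y}, {x : {X // A X} | Inc p x.1 l.1}.ncard = p + 1 := fun l => K.count H l.2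
  have hlx : ∀ x : {X // A X}, {l : {Y // B Y} | Inc p x.1 l.1}.ncard = p + 1 := by
    intro x
    rw [← K.symm.count H x.2]
    congr 1
    ext l
    exact ⟨Inc.symm, Inc.symm⟩
  have hfree : ∀ (l : {Y // B Y}) (x : {X // A X}), ¬ Inc p x.1 l.1 → ∀ u ∈ l.1, u • x = x → u = 1 := by
    intro l x h u hu hux
    by_contra hu1
    exact h (K.inc_of_norm H x.2 l.2 hu hu1 (congrArg Subtype.val hux))
  have hfix : ∀ (l : {Y // B Y}) (x : {X // A X}), Inc p x.1 l.1 → ∀ u ∈ l.1, u • x = x := by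
    intro l x h u hu
    exact Subtype.ext (K.norm H x.2 h hu)
  have hinv : ∀ (g : G) (x : {X // A X}) (l : {Y // B Y}), Inc p x.1 l.1 → Inc p (g • x).1 (g • l).1 := by
    rintro g x l ⟨Q, h1, h2⟩
    exact ⟨g • Q, conj_le_smul h1, conj_le_smul h2⟩
  have hUl : ∀ (l : {Y // B Y}), ∀ u ∈ l.1, u • l = l := by
    intro l u hu
    apply Subtype.ext
    rw [sB]
    exact conj_eq_of_le fun e he => l.1.mul_mem (l.1.mul_mem hu he) (l.1.inv_mem hu)
  constructor
  · exact hinv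
  · exact fun x y hxy => join_of_count _ p uq hpl hlx (K.card H) x y hxy
  · intro l m hlm
    exact join_of_count (fun (l : {Y // B Y}) (x : {X // A X}) => Inc p x.1 l.1) p uq' hlx hpl
      (K.symm.card H) l m hlm
  · exact uq
  · exact hpl
  · exact hlx
  · infer_instance
  · exact K.card H
  · exact fun l => (K.goodB _ l.2).1
  · exact fun l a ha b hb => comm_of_card_sq (K.goodB _ l.2).1 ha hb
  · exact fun l a ha => H.Good_exp (K.goodB _ l.2) ha
  · exact hfix
  · exact hfree
  · intro l x y hx hy
    have hc : {x : {X // A X} | ¬ Inc p x.1 l.1}.ncard = p ^ 2 := by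
      have h1 := Set.ncard_add_ncard_compl {x : {X // A X} | Inc p x.1 l.1}
      rw [hpl, K.card H] at h1
      have : {x : {X // A X} | ¬ Inc p x.1 l.1} = {x : {X // A X} | Inc p x.1 l.1}ᶜ := rfl
      rw [this]; omega
    have := Set.surj_on_of_inj_on_of_ncard_le (s := (l.1 : Set G))
      (t := {x : {X // A X} | ¬ Inc p x.1 l.1}) (fun u _ => u • x) ?_ ?_ ?_ (Set.toFinite _) y hy
    · obtain ⟨u, hu, h⟩ := this
      exact ⟨u, hu, h.symm⟩
    · intro u hu h
      apply hx
      have := hinv u⁻¹ _ _ h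
      rwa [inv_smul_smul, hUl l _ (l.1.inv_mem hu)] at this
    · intro u v hu hv h
      have : v⁻¹ * u = 1 := by
        apply hfree l x hx _ (l.1.mul_mem (l.1.inv_mem hv) hu)
        rw [mul_smul, inv_smul_eq_iff]; exact h
      exact (inv_mul_eq_one.1 this).symm
    · rw [hc]; exact (K.goodB _ l.2).1.symm.le
  · intro l u hu
    by_cases hu1 : u = 1
    · obtain ⟨x, hx⟩ : {x : {X // A X} | Inc p x.1 l.1}.Nonempty := by
        rw [← Set.ncard_pos, hpl]; omega
      exact ⟨x, hx, fun m _ => by rw [hu1, one_smul]⟩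
    · obtain ⟨Q, hQ, huQ⟩ := H.Good_cover (K.goodB _ l.2) hu hu1
      obtain ⟨X, hX, hXQ⟩ := K.exA Q
      refine ⟨⟨X, hX⟩, ⟨Q, hXQ, hQ⟩, fun m hm => Subtype.ext ?_⟩
      have huX := H.Zc_le_sq (K.goodA _ hX).1 hXQ huQ
      exact K.symm.norm H m.2 hm.symm huX

end
end OD

namespace OD
section
variable {G Pt Ln : Type*} [Group G] [MulAction G Pt] [MulAction G Ln] {p : ℕ} [hpf : Fact p.Prime]
  {I : Pt → Ln → Prop} {U : Ln → Subgroup G}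

theorem Plane.third (L : Plane G Pt Ln p I U) (l : Ln) (x y : Pt) :
    ∃ z, I z l ∧ z ≠ x ∧ z ≠ y := by
  have := L.fin
  have h2 := hpf.out.two_le
  have h : ({x, y} : Set Pt).ncard < {x | I x l}.ncard := by
    rw [L.ptsl]
    have := Set.ncard_insert_le x {y}
    rw [Set.ncard_singleton] at this
    omega
  obtain ⟨z, hz, hz'⟩ := Set.exists_mem_notMem_of_ncard_lt_ncard h
  simp only [Set.mem_insert_iff, Set.mem_singleton_iff, not_or] at hz'
  exact ⟨z, hz, hz'⟩

theorem Plane.off (L : Plane G Pt Ln p I U) (l : Ln) : ∃ x, ¬ I x l := by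
  by_contra h
  push Not at h
  have h1 := L.ptsl l
  have : {x | I x l} = Set.univ := by ext x; simp [h x]
  rw [this, Set.ncard_univ, L.card] at h1
  have := hpf.out.two_le
  nlinarith

theorem Plane.fixl (L : Plane G Pt Ln p I U) {l : Ln} {u : G} (hu : u ∈ U l) : u • l = l := by
  have := L.fin
  have : Nonempty Pt := by
    by_contra h
    rw [not_nonempty_iff] at h
    have := L.card
    rw [Nat.card_of_isEmpty] at this
    have := hpf.out.two_le
    nlinarith
  obtain ⟨x0⟩ := this
  obtain ⟨x, hx, -, -⟩ := L.third l x0 x0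
  obtain ⟨y, hy, hxy, -⟩ := L.third l x x
  have h1 := L.inv u x l hx
  have h2 := L.inv u y l hy
  rw [L.Ufix l x hx u hu] at h1
  rw [L.Ufix l y hy u hu] at h2
  exact L.uniq y x _ _ hxy h2 h1 hy hx

theorem Plane.cmove (L : Plane G Pt Ln p I U) {u : G} {c q : Pt} {m : Ln}
    (hc : ∀ m, I c m → u • m = m) (hm : I c m) (hq : I q m) : I (u • q) m := by
  have := L.inv u q m hq
  rwa [hc m hm] at this

theorem Plane.cuniq (L : Plane G Pt Ln p I U) {l : Ln} {u : G} {c c' : Pt} (hu : u ∈ U l) (h1 : u ≠ 1)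
    (hcl : I c l) (hcl' : I c' l)
    (hc : ∀ m, I c m → u • m = m) (hc' : ∀ m, I c' m → u • m = m) : c = c' := by
  by_contra hne
  obtain ⟨q, hq⟩ := L.off l
  obtain ⟨m, hm1, hm2⟩ := L.join c q (by rintro rfl; exact hq hcl)
  obtain ⟨m', hm1', hm2'⟩ := L.join c' q (by rintro rfl; exact hq hcl')
  have hmm : m ≠ m' := by
    rintro rfl
    have := L.uniq c c' m l hne hm1 hm1' hcl hcl'
    exact hq (this ▸ hm2)
  apply h1
  apply L.Ufree l q hq u hu
  by_contra hqq
  exact hmm (L.uniq _ _ m m' hqq (L.cmove hc hm1 hm2) hm2 (L.cmove hc' hm1' hm2') hm2')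

theorem exists_addEquiv (A : Type*) [AddCommGroup A] (hc : Nat.card A = p ^ 2)
    (hexp : ∀ x : A, p • x = 0) : Nonempty ((Fin 2 → ZMod p) ≃+ A) := by
  let _ : Module (ZMod p) A := AddCommGroup.zmodModule (n := p) hexp
  have hf : Finite A := Nat.finite_of_card_ne_zero (by
    rw [hc]; exact pow_ne_zero _ hpf.out.ne_zero)
  have : Module.Finite (ZMod p) A := Module.Finite.of_finite
  have hr : Module.finrank (ZMod p) A = 2 := by
    have h1 := Module.natCard_eq_pow_finrank (K := ZMod p) (V := A)
    rw [hc, Nat.card_zmod] at h1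
    exact (Nat.pow_right_injective hpf.out.two_le h1).symm
  let e : (Fin 2 → ZMod p) ≃ₗ[ZMod p] A :=
    LinearEquiv.ofFinrankEq _ _ (by rw [hr]; simp)
  exact ⟨e.toAddEquiv⟩

theorem exists_coord {H : Subgroup G} (hc : Nat.card H = p ^ 2)
    (hcomm : ∀ a ∈ H, ∀ b ∈ H, a * b = b * a) (hexp : ∀ a ∈ H, a ^ p = 1) :
    ∃ y : (Fin 2 → ZMod p) → G, (∀ a b, y (a + b) = y a * y b) ∧ (∀ a, y a ∈ H) ∧
      (∀ u ∈ H, ∃ a, y a = u) ∧ (∀ a, y a = 1 → a = 0) := by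
  let _ : CommGroup H := { (inferInstance : Group H) with
    mul_comm := fun a b => Subtype.ext (hcomm a a.2 b b.2) }
  obtain ⟨e⟩ := exists_addEquiv (p := p) (Additive H) hc (by
    intro x
    have : (Additive.toMul x) ^ p = 1 := Subtype.ext (hexp _ (Additive.toMul x).2)
    exact this)
  refine ⟨fun a => ((e a).toMul : H).1, ?_, ?_, ?_, ?_⟩
  · intro a b; beta_reduce; rw [map_add]; rfl
  · intro a; exact ((e a).toMul : H).2
  · intro u hu
    refine ⟨e.symm (Additive.ofMul ⟨u, hu⟩), ?_⟩
    beta_reduce; rw [AddEquiv.apply_symm_apply]; rfl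
  · intro a ha
    have : e a = 0 := Additive.toMul.injective (Subtype.ext ha)
    simpa using this

/-- Projective coordinates on a plane. -/
structure Coord (F : Type*) [Field F] {Pt Ln : Type*} (I : Pt → Ln → Prop)
    (ψ : (Fin 3 → F) → Pt) : Prop where
  smul : ∀ (s : F) v, s ≠ 0 → v ≠ 0 → ψ (s • v) = ψ v
  surj : ∀ x, ∃ v, v ≠ 0 ∧ ψ v = x
  inj : ∀ v w, v ≠ 0 → w ≠ 0 → ψ v = ψ w → ∃ s : F, s ≠ 0 ∧ s • v = w
  line : ∀ f : Fin 3 → F, f ≠ 0 → ∃ m, ∀ v, v ≠ 0 → (I (ψ v) m ↔ f ⬝ᵥ v = 0)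

open scoped LinearAlgebra.Projectivization in
theorem card_P2 : Nat.card (ℙ (ZMod p) (Fin 3 → ZMod p)) = p ^ 2 + p + 1 := by
  have := Projectivization.card_of_finrank (ZMod p) (Fin 3 → ZMod p) (n := 3) (by simp)
  rw [this]
  simp [Finset.sum_range_succ]; ring

open scoped LinearAlgebra.Projectivization in
theorem inj_of_surj (_hfin : Finite Pt) (hcard : Nat.card Pt = p ^ 2 + p + 1)
    (ψ : (Fin 3 → ZMod p) → Pt)
    (smul : ∀ (s : ZMod p) v, s ≠ 0 → v ≠ 0 → ψ (s • v) = ψ v)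
    (surj : ∀ x, ∃ v, v ≠ 0 ∧ ψ v = x) :
    ∃ e : ℙ (ZMod p) (Fin 3 → ZMod p) ≃ Pt, ∀ v (hv : v ≠ 0), e (Projectivization.mk _ v hv) = ψ v := by
  let e0 : ℙ (ZMod p) (Fin 3 → ZMod p) → Pt := fun x => ψ x.rep
  have h0 : ∀ v (hv : v ≠ 0), e0 (Projectivization.mk _ v hv) = ψ v := by
    intro v hv
    obtain ⟨a, ha⟩ := Projectivization.exists_smul_eq_mk_rep (ZMod p) v hv
    show ψ (Projectivization.rep _) = ψ v
    rw [← ha]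
    exact smul a v a.ne_zero hv
  have hs : Function.Surjective e0 := by
    intro x
    obtain ⟨v, hv, rfl⟩ := surj x
    exact ⟨_, h0 v hv⟩
  have hb : Function.Bijective e0 := by
    rw [Nat.bijective_iff_surjective_and_card]
    exact ⟨hs, by rw [card_P2, hcard]⟩
  exact ⟨Equiv.ofBijective e0 hb, h0⟩

theorem Plane.exists_psi (L : Plane G Pt Ln p I U) : ∃ ψ : (Fin 3 → ZMod p) → Pt, Coord (ZMod p) I ψ := by
  classical
  have := L.fin
  obtain ⟨l, -⟩ : ∃ l : Ln, True := by
    have : Nonempty Pt := by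
      by_contra h
      rw [not_nonempty_iff] at h
      have := L.card
      rw [Nat.card_of_isEmpty] at this
      have := hpf.out.two_le
      nlinarith
    obtain ⟨x0⟩ := this
    have : {l | I x0 l}.ncard ≠ 0 := by rw [L.lnsx]; omega
    obtain ⟨l, -⟩ := Set.nonempty_of_ncard_ne_zero this
    exact ⟨l, trivial⟩
  obtain ⟨O, hO⟩ := L.off l
  obtain ⟨y, yadd, ymem, ysurj, yinj⟩ := exists_coord (L.Ucard l) (L.Ucomm l) (L.Uexp l)
  choose D hDl hD using fun w => L.Ucen l (y w) (ymem w)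
  have y0 : y 0 = 1 := by
    have := yadd 0 0
    rw [add_zero] at this
    simpa using this
  have ypow : ∀ (n : ℕ) w, y (n • w) = y w ^ n := by
    intro n w
    induction n with
    | zero => simp [y0]
    | succ n ih => rw [succ_nsmul, yadd, ih, pow_succ]
  have ysmul : ∀ (s : ZMod p) w, y (s • w) = y w ^ s.val := by
    intro s w
    rw [← ypow]
    congr 1
    rw [← Nat.cast_smul_eq_nsmul (ZMod p), ZMod.natCast_zmod_val]
  have yoff : ∀ w, ¬ I (y w • O) l := by
    intro w h
    have := L.inv (y w)⁻¹ _ _ h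
    rw [inv_smul_smul, L.fixl ((U l).inv_mem (ymem w))] at this
    exact hO this
  have Dsmul : ∀ (s : ZMod p) w, s ≠ 0 → w ≠ 0 → D (s • w) = D w := by
    intro s w hs hw
    have hsw : s • w ≠ 0 := smul_ne_zero hs hw
    apply L.cuniq (ymem (s • w)) (fun h => hsw (yinj _ h)) (hDl _) (hDl _) (hD _)
    intro m hm
    rw [ysmul]
    have h1 := hD w m hm
    generalize s.val = n
    induction n with
    | zero => simp
    | succ n ih => rw [pow_succ, mul_smul, h1, ih]
  have Dsurj : ∀ c, I c l → ∃ w, w ≠ 0 ∧ D w = c := by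
    intro c hc
    obtain ⟨m, hm1, hm2⟩ := L.join c O (by rintro rfl; exact hO hc)
    obtain ⟨z, hz, hzc, hzO⟩ := L.third m c O
    have hml : m ≠ l := by rintro rfl; exact hO hm2
    have hzl : ¬ I z l := fun h => hml (L.uniq z c m l hzc hz hm1 h hc)
    obtain ⟨u, hu, huO⟩ := L.Utrans l O z hO hzl
    obtain ⟨w, rfl⟩ := ysurj u hu
    have hw : w ≠ 0 := by
      rintro rfl
      rw [y0, one_smul] at huO
      exact hzO huO.symm
    refine ⟨w, hw, ?_⟩
    obtain ⟨m', hm1', hm2'⟩ := L.join (D w) O (by intro h; exact hO (h ▸ hDl w))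
    have h3 := L.cmove (hD w) hm1' hm2'
    rw [huO] at h3
    have h4 := L.uniq z O m m' hzO hz hm2 h3 hm2'
    subst h4
    by_contra hne
    exact hml (L.uniq _ _ m l hne hm1' hm1 (hDl w) hc)
  let A : (Fin 3 → ZMod p) → (Fin 2 → ZMod p) := fun v => ![v 0, v 1]
  have Asmul : ∀ (s : ZMod p) v, A (s • v) = s • A v := by
    intro s v; ext i; fin_cases i <;> simp [A]
  let ψ : (Fin 3 → ZMod p) → Pt := fun v => if v 2 = 0 then D (A v) else y ((v 2)⁻¹ • A v) • O
  have Ane : ∀ v, v ≠ 0 → v 2 = 0 → A v ≠ 0 := by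
    intro v hv h2 h
    apply hv
    ext i
    have e0 := congrFun h 0
    have e1 := congrFun h 1
    fin_cases i
    · exact e0
    · exact e1
    · exact h2
  have psmul : ∀ (s : ZMod p) v, s ≠ 0 → v ≠ 0 → ψ (s • v) = ψ v := by
    intro s v hs hv
    by_cases h2 : v 2 = 0
    · simp only [ψ, h2, Pi.smul_apply, smul_zero, if_true, Asmul]
      exact Dsmul s _ hs (Ane v hv h2)
    · have h3 : (s • v) 2 ≠ 0 := by simp [h2, hs]
      simp only [ψ, h2, h3, if_false, Asmul]
      rw [smul_smul]
      congr 3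
      simp only [Pi.smul_apply, smul_eq_mul]
      field_simp
  have pinf : ∀ w : Fin 2 → ZMod p, ψ ![w 0, w 1, 0] = D w := by
    intro w
    have : A ![w 0, w 1, 0] = w := by ext i; fin_cases i <;> simp [A]
    simp [ψ, this]
  have paff : ∀ w : Fin 2 → ZMod p, ψ ![w 0, w 1, 1] = y w • O := by
    intro w
    have : A ![w 0, w 1, 1] = w := by ext i; fin_cases i <;> simp [A]
    simp [ψ, this]
  have psurj : ∀ x, ∃ v, v ≠ 0 ∧ ψ v = x := by
    intro x
    by_cases hx : I x l
    · obtain ⟨w, hw, rfl⟩ := Dsurj x hx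
      refine ⟨_, ?_, pinf w⟩
      intro h
      apply hw
      have e0 := congrFun h 0
      have e1 := congrFun h 1
      ext i; fin_cases i
      · exact e0
      · exact e1
    · obtain ⟨u, hu, h⟩ := L.Utrans l O x hO hx
      obtain ⟨w, rfl⟩ := ysurj u hu
      refine ⟨_, ?_, (paff w).trans h⟩
      intro h
      have := congrFun h 2
      simp at this
  obtain ⟨e, he⟩ := inj_of_surj L.fin L.card ψ psmul psurj
  have pinj : ∀ v w, v ≠ 0 → w ≠ 0 → ψ v = ψ w → ∃ s : ZMod p, s ≠ 0 ∧ s • v = w := by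
    intro v w hv hw h
    rw [← he v hv, ← he w hw] at h
    have := e.injective h
    rw [eq_comm, Projectivization.mk_eq_mk_iff] at this
    obtain ⟨a, ha⟩ := this
    exact ⟨a, a.ne_zero, ha⟩
  refine ⟨ψ, psmul, psurj, pinj, ?_⟩
  have pl : ∀ v, I (ψ v) l ↔ v 2 = 0 := by
    intro v
    by_cases h2 : v 2 = 0
    · simp only [ψ, h2, if_true, iff_true]; exact hDl _
    · simp only [ψ, h2, if_false, iff_false]; exact yoff _
  intro f hf
  by_cases h01 : f 0 = 0 ∧ f 1 = 0
  · have h2 : f 2 ≠ 0 := by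
      intro h2; apply hf; ext i; fin_cases i
      · exact h01.1
      · exact h01.2
      · exact h2
    refine ⟨l, fun v _ => ?_⟩
    rw [pl]
    simp [dotProduct, Fin.sum_univ_three, h01.1, h01.2, h2]
  obtain ⟨w0, hw0⟩ : ∃ w0 : Fin 2 → ZMod p, f 0 * w0 0 + f 1 * w0 1 + f 2 = 0 := by
    by_cases h0 : f 0 = 0
    · have h1 : f 1 ≠ 0 := fun h => h01 ⟨h0, h⟩
      refine ⟨![0, -f 2 / f 1], ?_⟩
      simp; field_simp; ring
    · refine ⟨![-f 2 / f 0, 0], ?_⟩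
      simp; field_simp; ring
  let δ : Fin 2 → ZMod p := ![-f 1, f 0]
  have hδ : δ ≠ 0 := by
    intro h
    have e0 : - f 1 = 0 := congrFun h 0
    have e1 : f 0 = 0 := congrFun h 1
    exact h01 ⟨e1, neg_eq_zero.1 e0⟩
  obtain ⟨m, hm1, hm2⟩ := L.join (D δ) (y w0 • O) (by intro h; exact yoff w0 (h ▸ hDl δ))
  have hml : m ≠ l := by rintro rfl; exact yoff _ hm2
  have key : ∀ a b : ZMod p, f 0 * a + f 1 * b = 0 → ∃ s : ZMod p, ![a, b] = s • δ := by
    intro a b hab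
    by_cases h0 : f 0 = 0
    · have h1 : f 1 ≠ 0 := fun h => h01 ⟨h0, h⟩
      refine ⟨-a / f 1, ?_⟩
      rw [h0, zero_mul, zero_add] at hab
      have hb : b = 0 := (mul_eq_zero.1 hab).resolve_left h1
      ext i; fin_cases i
      · simp [δ]; field_simp
      · simp [δ, hb, h0]
    · refine ⟨b / f 0, ?_⟩
      have ha : a = - f 1 * b / f 0 := by field_simp; linear_combination hab
      ext i; fin_cases i
      · simp [δ, ha]; ring
      · simp [δ]; field_simp
  have Dinj : ∀ w w' : Fin 2 → ZMod p, w ≠ 0 → w' ≠ 0 → D w = D w' → ∃ s : ZMod p, s ≠ 0 ∧ s • w = w' := by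
    have hn : ∀ w : Fin 2 → ZMod p, w ≠ 0 → ![w 0, w 1, 0] ≠ 0 := by
      intro w hw h
      apply hw
      have e0 := congrFun h 0
      have e1 := congrFun h 1
      ext i; fin_cases i
      · exact e0
      · exact e1
    intro w w' hw hw' h
    rw [← pinf, ← pinf] at h
    obtain ⟨s, hs, h⟩ := pinj _ _ (hn w hw) (hn w' hw') h
    refine ⟨s, hs, ?_⟩
    have e0 := congrFun h 0
    have e1 := congrFun h 1
    ext i; fin_cases i
    · exact e0
    · exact e1
  have minf : ∀ w, w ≠ 0 → (I (D w) m ↔ f 0 * w 0 + f 1 * w 1 = 0) := by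
    intro w hw
    constructor
    · intro h
      have : D δ = D w := by
        by_contra hne
        exact hml (L.uniq _ _ m l hne hm1 h (hDl _) (hDl _))
      obtain ⟨s, hs, rfl⟩ := Dinj _ _ hδ hw this
      simp [δ]; ring
    · intro h
      obtain ⟨s, hs⟩ := key _ _ h
      have hs2 : w = s • δ := by
        rw [← hs]; ext i; fin_cases i <;> rfl
      have hs0 : s ≠ 0 := by rintro rfl; apply hw; rw [hs2, zero_smul]
      rw [hs2, Dsmul s δ hs0 hδ]; exact hm1
  have maff : ∀ w, (I (y w • O) m ↔ f 0 * w 0 + f 1 * w 1 + f 2 = 0) := by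
    intro w
    have hyy : y w • O = y (w - w0) • (y w0 • O) := by
      rw [smul_smul, ← yadd, sub_add_cancel]
    constructor
    · intro h
      by_cases hww : w = w0
      · rw [hww]; exact hw0
      have hne : w - w0 ≠ 0 := sub_ne_zero.2 hww
      obtain ⟨m', hm1', hm2'⟩ := L.join (D (w - w0)) (y w0 • O)
        (by intro h; exact yoff w0 (h ▸ hDl (w - w0)))
      have h3 := L.cmove (hD (w - w0)) hm1' hm2'
      rw [← hyy] at h3
      have hne2 : y w • O ≠ y w0 • O := by
        intro h
        rw [hyy] at h
        exact hne (yinj _ (L.Ufree l _ (yoff w0) _ (ymem _) h))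
      have := L.uniq _ _ m m' hne2 h hm2 h3 hm2'
      subst this
      have := (minf _ hne).1 hm1'
      simp only [Pi.sub_apply] at this
      linear_combination this + hw0
    · intro h
      rw [hyy]
      by_cases hww : w = w0
      · rw [hww, sub_self, y0, one_smul]; exact hm2
      have hne : w - w0 ≠ 0 := sub_ne_zero.2 hww
      apply L.cmove (hD (w - w0)) _ hm2
      apply (minf _ hne).2
      simp only [Pi.sub_apply]
      linear_combination h - hw0
  refine ⟨m, fun v hv => ?_⟩
  simp only [dotProduct, Fin.sum_univ_three]
  by_cases h2 : v 2 = 0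
  · simp only [ψ, h2, if_true]
    rw [minf _ (Ane v hv h2)]
    simp [A]
  · simp only [ψ, h2, if_false]
    rw [maff]
    simp only [Pi.smul_apply, smul_eq_mul, A, Matrix.cons_val_zero, Matrix.cons_val_one]
    constructor
    · intro h; field_simp at h; linear_combination h
    · intro h; field_simp; linear_combination h

end
end OD

namespace OD
section
variable {G Pt Ln : Type*} [Group G] [MulAction G Pt] [MulAction G Ln] {p : ℕ} [hpf : Fact p.Prime]
  {I : Pt → Ln → Prop} {U : Ln → Subgroup G} {F : Type*} [Field F]

/-- vector with prescribed coordinates -/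
def vec (i j : Fin 3) (a b c : F) : Fin 3 → F := fun x => if x = i then a else if x = j then b else c

theorem vec_i (i j : Fin 3) (a b c : F) : vec i j a b c i = a := by simp [vec]
theorem vec_j {i j : Fin 3} (h : i ≠ j) (a b c : F) : vec i j a b c j = b := by simp [vec, h.symm]
theorem vec_k {i j k : Fin 3} (h : i ≠ k) (h' : j ≠ k) (a b c : F) : vec i j a b c k = c := by
  simp [vec, h.symm, h'.symm]

theorem dot3 {i j k : Fin 3} (hij : i ≠ j) (hik : i ≠ k) (hjk : j ≠ k) (f v : Fin 3 → F) :
    f ⬝ᵥ v = f i * v i + f j * v j + f k * v k := by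
  simp only [dotProduct, Fin.sum_univ_three]
  revert i j k
  intro i j k
  fin_cases i <;> fin_cases j <;> fin_cases k <;> simp <;> ring

theorem ext3 {i j k : Fin 3} (hij : i ≠ j) (hik : i ≠ k) (hjk : j ≠ k) {f v : Fin 3 → F}
    (h1 : f i = v i) (h2 : f j = v j) (h3 : f k = v k) : f = v := by
  ext x
  have : x = i ∨ x = j ∨ x = k := by clear h1 h2 h3; revert i j k x; decide
  rcases this with rfl | rfl | rfl <;> assumption

/-- transvection -/
def tv (i j : Fin 3) (s : F) (v : Fin 3 → F) : Fin 3 → F := v + Pi.single i (s * v j)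

theorem tv_i (i j : Fin 3) (s : F) (v : Fin 3 → F) : tv i j s v i = v i + s * v j := by simp [tv]
theorem tv_ne {i j x : Fin 3} (h : i ≠ x) (s : F) (v : Fin 3 → F) : tv i j s v x = v x := by
  simp [tv, h.symm]

theorem tv_smul (i j : Fin 3) (s a : F) (v : Fin 3 → F) : tv i j s (a • v) = a • tv i j s v := by
  ext x
  simp only [tv, Pi.add_apply, Pi.smul_apply, smul_eq_mul, Pi.single_apply]
  split_ifs <;> ring

theorem ne_of_apply (v : Fin 3 → F) (x : Fin 3) (h : v x ≠ 0) : v ≠ 0 := by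
  rintro rfl; exact h rfl

theorem Plane.tv_step (L : Plane G Pt Ln p I U) {ψ : (Fin 3 → F) → Pt} (C : Coord F I ψ)
    {i j k : Fin 3} (hij : i ≠ j) (hik : i ≠ k) (hjk : j ≠ k) (s : F) (h : G)
    (hax : ∀ v, v ≠ 0 → v j = 0 → h • ψ v = ψ v)
    (hcen : ∀ m, I (ψ (vec i j 1 0 0)) m → h • m = m)
    (q v : Fin 3 → F) (hq : q j = 1) (hv : v j = 1) (hk : v k ≠ q k)
    (hhq : h • ψ q = ψ (tv i j s q)) : h • ψ v = ψ (tv i j s v) := by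
  have hei : vec i j (1 : F) 0 0 ≠ 0 := ne_of_apply _ i (by simp [vec])
  have hq0 : q ≠ 0 := ne_of_apply _ j (by simp [hq])
  have hv0 : v ≠ 0 := ne_of_apply _ j (by simp [hv])
  have hTq0 : tv i j s q ≠ 0 := ne_of_apply _ j (by simp [tv_ne hij, hq])
  have hTv0 : tv i j s v ≠ 0 := ne_of_apply _ j (by simp [tv_ne hij, hv])
  have hd0 : v - q ≠ 0 := ne_of_apply _ k (by simpa [sub_ne_zero] using hk)
  obtain ⟨m1, hm1⟩ := C.line (vec i j 0 (v k) (-1)) (ne_of_apply _ k (by simp [vec_k hik hjk]))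
  set g : Fin 3 → F := vec i j (v k - q k) (-((v k - q k) * q i - (v i - q i) * q k)) (-(v i - q i)) with hg
  set g' : Fin 3 → F := vec i j (g i) (g j - s * g i) (g k) with hg'
  have hgi : g i = v k - q k := vec_i _ _ _ _ _
  have hgj : g j = _ := vec_j hij _ _ _
  have hgk : g k = _ := vec_k hik hjk _ _ _
  have hgi' : g' i = g i := vec_i _ _ _ _ _
  have hgj' : g' j = g j - s * g i := vec_j hij _ _ _
  have hgk' : g' k = g k := vec_k hik hjk _ _ _
  have hne : v k - q k ≠ 0 := sub_ne_zero.2 hk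
  obtain ⟨m2, hm2⟩ := C.line g (ne_of_apply _ i (by rw [hgi]; exact hne))
  obtain ⟨m3, hm3⟩ := C.line g' (ne_of_apply _ i (by rw [hgi', hgi]; exact hne))
  simp only [dot3 hij hik hjk] at hm1 hm2 hm3
  obtain ⟨m0, hm0⟩ := C.line (vec i j 0 1 0) (ne_of_apply _ j (by simp [vec_j hij]))
  simp only [dot3 hij hik hjk] at hm0
  have e1 : h • m2 = m3 := by
    apply L.uniq (ψ (v - q)) (ψ (tv i j s q))
    · intro he
      have h1 : I (ψ (v - q)) m0 := by
        rw [hm0 _ hd0]; simp [vec_i, vec_j hij, vec_k hik hjk, hq, hv]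
      rw [he, hm0 _ hTq0] at h1
      simp [vec_i, vec_j hij, vec_k hik hjk, hq, tv_ne hij] at h1
    · have := L.inv h (ψ (v - q)) m2 (by
        rw [hm2 _ hd0, hgi, hgj, hgk]
        simp only [Pi.sub_apply, hq, hv]; ring)
      rwa [hax _ hd0 (by simp [hq, hv])] at this
    · rw [← hhq]
      apply L.inv
      rw [hm2 _ hq0, hgi, hgj, hgk, hq]; ring
    · rw [hm3 _ hd0, hgi', hgj', hgk', hgi, hgj, hgk]
      simp only [Pi.sub_apply, hq, hv]; ring
    · rw [hm3 _ hTq0, hgi', hgj', hgk', hgi, hgj, hgk, tv_i, tv_ne hij, tv_ne hik, hq]; ring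
  by_contra hcon
  have e2 : m1 = m3 := by
    apply L.uniq _ _ m1 m3 hcon
    · apply L.cmove hcen
      · rw [hm1 _ hei]; simp [vec_i, vec_j hij, vec_k hik hjk]
      · rw [hm1 _ hv0]; simp [vec_i, vec_j hij, vec_k hik hjk, hv]
    · rw [hm1 _ hTv0]; simp [vec_i, vec_j hij, vec_k hik hjk, hv, tv_ne hij, tv_ne hik]
    · rw [← e1]
      apply L.inv
      rw [hm2 _ hv0, hgi, hgj, hgk, hv]; ring
    · rw [hm3 _ hTv0, hgi', hgj', hgk', hgi, hgj, hgk, tv_i, tv_ne hij, tv_ne hik, hv]; ring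
  have h1 : I (ψ (v - q)) m3 := by
    rw [hm3 _ hd0, hgi', hgj', hgk', hgi, hgj, hgk]
    simp only [Pi.sub_apply, hq, hv]; ring
  rw [← e2, hm1 _ hd0] at h1
  simp only [vec_i, vec_j hij, vec_k hik hjk, Pi.sub_apply, hq, hv] at h1
  apply hne
  linear_combination -h1

theorem Plane.exists_tv (L : Plane G Pt Ln p I U) {ψ : (Fin 3 → F) → Pt} (C : Coord F I ψ)
    {i j : Fin 3} (hij : i ≠ j) (s : F) : ∃ h : G, ∀ v, v ≠ 0 → h • ψ v = ψ (tv i j s v) := by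
  by_cases hs : s = 0
  · refine ⟨1, fun v _ => ?_⟩
    rw [one_smul, hs]; simp [tv]
  obtain ⟨k, hik, hjk⟩ : ∃ k, i ≠ k ∧ j ≠ k := by revert i j; decide
  have hei : vec i j (1 : F) 0 0 ≠ 0 := ne_of_apply _ i (by simp [vec])
  set ej : Fin 3 → F := vec i j (0 : F) 1 0 with hejd
  have hej : ej ≠ 0 := ne_of_apply _ j (by simp [hejd, vec_j hij])
  have ejj : ej j = 1 := vec_j hij _ _ _
  have eji : ej i = 0 := vec_i _ _ _ _ _
  have ejk : ej k = 0 := vec_k hik hjk _ _ _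
  have hTe : tv i j s ej ≠ 0 := ne_of_apply _ j (by simp [tv_ne hij, ejj])
  obtain ⟨m0, hm0⟩ := C.line ej hej
  obtain ⟨mk, hmk⟩ := C.line (vec i j 0 0 1) (ne_of_apply _ k (by simp [vec_k hik hjk]))
  simp only [dot3 hij hik hjk, ejj, eji, ejk, vec_i, vec_j hij, vec_k hik hjk, zero_mul, one_mul, zero_add,
    add_zero] at hm0 hmk
  obtain ⟨h, hh, hhe⟩ := L.Utrans m0 (ψ ej) (ψ (tv i j s ej)) (by rw [hm0 _ hej, ejj]; simp)
    (by rw [hm0 _ hTe, tv_ne hij, ejj]; simp)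
  have hax : ∀ v, v ≠ 0 → v j = 0 → h • ψ v = ψ v := by
    intro v hv hvj
    exact L.Ufix m0 _ ((hm0 v hv).2 hvj) h hh
  obtain ⟨c, hc0, hc⟩ := L.Ucen m0 h hh
  have hcei : c = ψ (vec i j 1 0 0) := by
    obtain ⟨w, hw, rfl⟩ := C.surj c
    have hwj : w j = 0 := (hm0 w hw).1 hc0
    obtain ⟨n, hn1, hn2⟩ := L.join (ψ w) (ψ ej) (by
      intro he
      rw [he, hm0 _ hej, ejj] at hc0
      simp at hc0)
    have hn3 := L.cmove hc hn1 hn2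
    rw [hhe] at hn3
    have hnk : n = mk := by
      apply L.uniq _ _ n mk _ hn3 hn2
      · rw [hmk _ hTe, tv_ne hik, ejk]
      · rw [hmk _ hej, ejk]
      · intro he
        obtain ⟨a, -, ha⟩ := C.inj _ _ hTe hej he
        have h1 := congrFun ha i
        have h2 := congrFun ha j
        simp only [Pi.smul_apply, tv_i, tv_ne hij, ejj, eji, smul_eq_mul, mul_one, zero_add] at h1 h2
        rw [h2, one_mul] at h1
        exact hs h1
    rw [hnk, hmk _ hw] at hn1
    have : w i • vec i j 1 0 0 = w := by
      apply ext3 hij hik hjk <;> simp [vec_i, vec_j hij, vec_k hik hjk, hwj, hn1]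
    have hwi : w i ≠ 0 := by
      intro h0; rw [h0, zero_smul] at this; exact hw this.symm
    rw [← this]
    rw [C.smul _ _ hwi hei]
  rw [hcei] at hc
  have step := L.tv_step C hij hik hjk s h hax hc
  have s1 : ∀ v, v j = 1 → h • ψ v = ψ (tv i j s v) := by
    intro v hv
    by_cases hvk : v k = 0
    · set q : Fin 3 → F := vec i j 0 1 1 with hqd
      have qj : q j = 1 := vec_j hij _ _ _
      have qk : q k = 1 := vec_k hik hjk _ _ _
      refine step q v qj hv (by rw [hvk, qk]; exact zero_ne_one) ?_
      exact step ej q ejj qj (by rw [qk, ejk]; exact one_ne_zero) hhe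
    · exact step ej v ejj hv (by rw [ejk]; exact hvk) hhe
  refine ⟨h, fun v hv => ?_⟩
  by_cases hvj : v j = 0
  · rw [hax v hv hvj]
    congr 1
    simp [tv, hvj]
  · have hv' : (v j)⁻¹ • v ≠ 0 := smul_ne_zero (inv_ne_zero hvj) hv
    have := s1 ((v j)⁻¹ • v) (by simp [hvj])
    rw [tv_smul, C.smul _ _ (inv_ne_zero hvj) hv, C.smul _ _ (inv_ne_zero hvj)] at this
    · exact this
    · exact ne_of_apply _ j (by rw [tv_ne hij]; exact hvj)

open Matrix Matrix.SpecialLinearGroup in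
theorem SL_tv_induction (P : SpecialLinearGroup (Fin 3) F → Prop)
    (ht : ∀ (i j : Fin 3) (hij : i ≠ j) (a : F), P (SpecialLinearGroup.transvection hij a))
    (hmul : ∀ A B, P A → P B → P (A * B)) (M : SpecialLinearGroup (Fin 3) F) : P M := by
  refine diagonal_transvection_induction' P M (fun i j hij c hc => ?_) ht hmul
  have : diag2n hij c hc = SpecialLinearGroup.transvection hij c *
      SpecialLinearGroup.transvection hij.symm (- c⁻¹) *
      SpecialLinearGroup.transvection hij c *
      SpecialLinearGroup.transvection hij (-1) *
      SpecialLinearGroup.transvection hij.symm 1 *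
      SpecialLinearGroup.transvection hij (-1) := by
    apply Subtype.ext
    show (diagonal (fun k => if k = i then c else if k = j then c⁻¹ else 1) : Matrix (Fin 3) (Fin 3) F) =
      (1 + single i j c) * (1 + single j i (-c⁻¹)) * (1 + single i j c) * (1 + single i j (-1)) *
      (1 + single j i 1) * (1 + single i j (-1))
    simp only [add_mul, mul_add, mul_one, one_mul, single_mul_single_same,
      single_mul_single_of_ne _ _ _ _ hij, single_mul_single_of_ne _ _ _ _ hij.symm, zero_mul,
      mul_neg, neg_mul, mul_inv_cancel₀ hc, inv_mul_cancel₀ hc, zero_add, add_zero, neg_neg]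
    ext a b
    simp only [diagonal_apply, Matrix.add_apply, single_apply, one_apply]
    have : j ≠ i := hij.symm
    grind
  rw [this]
  refine hmul _ _ (hmul _ _ (hmul _ _ (hmul _ _ (hmul _ _ ?_ ?_) ?_) ?_) ?_) ?_
  all_goals exact ht _ _ _ _

open scoped LinearAlgebra.Projectivization in
open Matrix in
theorem Plane.exists_equiv (L : Plane G Pt Ln p I U) :
    ∃ e : ℙ (ZMod p) (Fin 3 → ZMod p) ≃ Pt, ∀ g : SpecialLinearGroup (Fin 3) (ZMod p),
      ∃ h : G, ∀ x, e (g • x) = h • e x := by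
  obtain ⟨ψ, C⟩ := L.exists_psi
  obtain ⟨e, he⟩ := inj_of_surj L.fin L.card ψ C.smul C.surj
  refine ⟨e, ?_⟩
  apply SL_tv_induction
  · intro i j hij a
    obtain ⟨h, hh⟩ := L.exists_tv C hij a
    refine ⟨h, fun x => ?_⟩
    induction x using Projectivization.ind with | _ v hv =>
    rw [Projectivization.smul_mk, he, he, hh v hv]
    congr 1
    show ((1 + Matrix.single i j a) *ᵥ v) = _
    simp [Matrix.add_mulVec, Matrix.single_mulVec_eq, tv, ← Pi.single_smul']
  · rintro A B ⟨h1, e1⟩ ⟨h2, e2⟩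
    exact ⟨h1 * h2, fun x => by rw [mul_smul, mul_smul, e1, e2]⟩

end
end OD

namespace OD
section
open scoped LinearAlgebra.Projectivization MatrixGroups
open Matrix

theorem card_SL3 : Nat.card (SpecialLinearGroup (Fin 3) (ZMod 67)) = 3 * (2 ^ 4 * 3 ^ 2 * 7 ^ 2 * 11 ^ 2 * 17 * 31 * 67 ^ 3) := by
  have : Fact (Nat.Prime 67) := ⟨by norm_num⟩
  have h1 := card_GL_field (𝔽 := ZMod 67) 3
  have h2 := Subgroup.card_mul_index (GeneralLinearGroup.det (n := Fin 3) (R := ZMod 67)).ker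
  have h3 := Subgroup.index_ker (GeneralLinearGroup.det (n := Fin 3) (R := ZMod 67))
  rw [MonoidHom.range_eq_top.2 GeneralLinearGroup.det_surjective, Subgroup.card_top,
    Nat.card_units, Nat.card_zmod] at h3
  have h4 : Nat.card (SpecialLinearGroup (Fin 3) (ZMod 67)) =
      Nat.card (GeneralLinearGroup.det (n := Fin 3) (R := ZMod 67)).ker := by
    apply Nat.card_congr
    refine Equiv.ofBijective (fun g => ⟨SpecialLinearGroup.toGL g, ?_⟩) ⟨?_, ?_⟩
    · rw [MonoidHom.mem_ker]
      apply Units.ext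
      exact g.2
    · intro g g' h
      exact SpecialLinearGroup.toGL_injective (congrArg Subtype.val h)
    · rintro ⟨g, hg⟩
      refine ⟨⟨g.1, ?_⟩, ?_⟩
      · rw [MonoidHom.mem_ker] at hg
        exact congrArg Units.val hg
      · apply Subtype.ext
        apply Units.ext
        rfl
  rw [h3, ← h4, h1] at h2
  simp only [Fin.prod_univ_three, ZMod.card] at h2
  norm_num at h2 ⊢
  omega

theorem card_PSL3 : 2 ^ 4 * 3 ^ 2 * 7 ^ 2 * 11 ^ 2 * 17 * 31 * 67 ^ 3 ≤ Nat.card PSL(3, ZMod 67) := by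
  have : Fact (Nat.Prime 67) := ⟨by norm_num⟩
  have h1 := Subgroup.card_eq_card_quotient_mul_card_subgroup
    (Subgroup.center (SpecialLinearGroup (Fin 3) (ZMod 67)))
  have h2 : Nat.card (Subgroup.center (SpecialLinearGroup (Fin 3) (ZMod 67))) ≤ 3 := by
    rw [Nat.card_congr (SpecialLinearGroup.center_equiv_rootsOfUnity' (0 : Fin 3)).toEquiv]
    exact card_rootsOfUnity _ _
  rw [card_SL3] at h1
  have h3 : Nat.card PSL(3, ZMod 67) = Nat.card (SpecialLinearGroup (Fin 3) (ZMod 67) ⧸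
    (Subgroup.center (SpecialLinearGroup (Fin 3) (ZMod 67)))) := rfl
  rw [h3]
  have h4 := Nat.mul_le_mul_left (Nat.card (SpecialLinearGroup (Fin 3) (ZMod 67) ⧸
    (Subgroup.center (SpecialLinearGroup (Fin 3) (ZMod 67))))) h2
  omega

theorem finish {G : Type*} [Group G] [Finite G] (H : Hyp G 67)
    (hcard : Nat.card G = 2 ^ 4 * 3 ^ 2 * 7 ^ 2 * 11 ^ 2 * 17 * 31 * 67 ^ 3) :
    Nonempty (G ≃* PSL(3, ZMod 67)) := by
  have : Fact (Nat.Prime 67) := ⟨by norm_num⟩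
  obtain ⟨A, B, K⟩ := H.exists_geo
  let _ := conjAction A K.cA
  let _ := conjAction B K.cB
  obtain ⟨e, he⟩ := (K.plane H).exists_equiv
  let α : G →* Equiv.Perm {X // A X} := MulAction.toPermHom G _
  let β : PSL(3, ZMod 67) →* Equiv.Perm {X // A X} :=
    (e.permCongrHom).toMonoidHom.comp (Projectivization.PSLAction.toPermHom (K := ZMod 67) (ι := Fin 3))
  have hβ : Function.Injective β :=
    (e.permCongrHom).injective.comp Matrix.ProjectiveSpecialLinearGroup.toPermHom_injective
  have hle : β.range ≤ α.range := by
    rintro _ ⟨x, rfl⟩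
    obtain ⟨g, rfl⟩ := QuotientGroup.mk_surjective x
    obtain ⟨h, hh⟩ := he g
    refine ⟨h, ?_⟩
    ext1 y
    obtain ⟨y, rfl⟩ := e.surjective y
    show h • e y = e (g • (e.symm (e y)))
    rw [Equiv.symm_apply_apply, hh]
  have c1 : Nat.card β.range = Nat.card PSL(3, ZMod 67) :=
    (Nat.card_congr (MonoidHom.ofInjective hβ).toEquiv).symm
  have c2 := Subgroup.card_le_of_le hle
  have c3 := card_PSL3
  have hs : Function.Surjective α.rangeRestrict := α.rangeRestrict_surjective
  have c4 := Nat.card_le_card_of_surjective _ hs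
  have hb : Function.Bijective α.rangeRestrict := by
    rw [Nat.bijective_iff_surjective_and_card]
    exact ⟨hs, by omega⟩
  have hr : β.range = α.range := Subgroup.eq_of_le_of_card_ge hle (by omega)
  exact ⟨(MulEquiv.ofBijective _ hb).trans
    ((MulEquiv.subgroupCongr hr.symm).trans (MonoidHom.ofInjective hβ).symm)⟩

end
end OD

namespace OD

section graph
variable {G : Type*} [Group G] [Finite G]

theorem adj_symm {p q : ℕ} (h : primeGraphAdj G p q) : primeGraphAdj G q p := by
  obtain ⟨a, b, c, d, e, g, hg⟩ := h
  exact ⟨a.symm, c, b, e, d, g, by rw [hg, mul_comm]⟩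

theorem adj_of_comm {p q : ℕ} (hp : p.Prime) (hq : q.Prime) (hpq : p ≠ q) {x y : G}
    (hx : orderOf x = p) (hy : orderOf y = q) (h : x * y = y * x) : primeGraphAdj G p q := by
  refine ⟨hpq, hp, hq, hx ▸ orderOf_dvd_natCard x, hy ▸ orderOf_dvd_natCard y, x * y, ?_⟩
  have hc : Commute x y := h
  rw [hc.orderOf_mul_eq_mul_orderOf_of_coprime, hx, hy]
  rw [hx, hy]
  exact (Nat.coprime_primes hp hq).2 hpq

theorem primes_mem (hcard : Nat.card G = 2 ^ 4 * 3 ^ 2 * 7 ^ 2 * 11 ^ 2 * 17 * 31 * 67 ^ 3)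
    {r : ℕ} (hr : r.Prime) (hd : r ∣ Nat.card G) :
    r = 2 ∨ r = 3 ∨ r = 7 ∨ r = 11 ∨ r = 17 ∨ r = 31 ∨ r = 67 := by
  rw [hcard] at hd
  have key : ∀ q k : ℕ, q.Prime → r ∣ q ^ k → r = q := fun q k hq h =>
    (Nat.prime_dvd_prime_iff_eq hr hq).1 (hr.dvd_of_dvd_pow h)
  have k1 : ∀ q : ℕ, q.Prime → r ∣ q → r = q := fun q hq h =>
    (Nat.prime_dvd_prime_iff_eq hr hq).1 h
  rcases (Nat.Prime.dvd_mul hr).1 hd with hd | hd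
  · rcases (Nat.Prime.dvd_mul hr).1 hd with hd | hd
    · rcases (Nat.Prime.dvd_mul hr).1 hd with hd | hd
      · rcases (Nat.Prime.dvd_mul hr).1 hd with hd | hd
        · rcases (Nat.Prime.dvd_mul hr).1 hd with hd | hd
          · rcases (Nat.Prime.dvd_mul hr).1 hd with hd | hd
            · have := key 2 _ (by norm_num) hd; tauto
            · have := key 3 _ (by norm_num) hd; tauto
          · have := key 7 _ (by norm_num) hd; tauto
        · have := key 11 _ (by norm_num) hd; tauto
      · have := k1 17 (by norm_num) hd; tauto
    · have := k1 31 (by norm_num) hd; tauto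
  · have := key 67 _ (by norm_num) hd; tauto

/-- degree bounded using a set of possible neighbours -/
theorem adj_of_deg {p : ℕ} (S : Finset ℕ) (hS : ∀ r, primeGraphAdj G p r → r ∈ S)
    (hdeg : primeGraphDeg G p = S.card) : ∀ r ∈ S, primeGraphAdj G p r := by
  classical
  intro r hr
  have hsub : (Nat.card G).primeFactors.filter (fun r => primeGraphAdj G p r) ⊆ S := by
    intro s hs
    exact hS s (Finset.mem_filter.1 hs).2
  have heq := Finset.eq_of_subset_of_card_le hsub (by
    rw [← hdeg]; unfold primeGraphDeg; apply le_of_eq; congr!)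
  rw [← heq] at hr
  exact (Finset.mem_filter.1 hr).2

theorem mem_of_deg {p : ℕ} (S : Finset ℕ) (hS : ∀ r ∈ S, primeGraphAdj G p r)
    (hdeg : primeGraphDeg G p = S.card) : ∀ r, primeGraphAdj G p r → r ∈ S := by
  classical
  intro r hr
  have hmem : ∀ s, primeGraphAdj G p s → s ∈ (Nat.card G).primeFactors.filter (fun r => primeGraphAdj G p r) := by
    intro s hs
    refine Finset.mem_filter.2 ⟨?_, hs⟩
    exact Nat.mem_primeFactors.2 ⟨hs.2.2.1, hs.2.2.2.2.1, Nat.card_pos.ne'⟩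
  have hsub : S ⊆ (Nat.card G).primeFactors.filter (fun r => primeGraphAdj G p r) :=
    fun s hs => hmem s (hS s hs)
  have heq := Finset.eq_of_subset_of_card_le hsub (by
    rw [← hdeg]; unfold primeGraphDeg; apply le_of_eq; congr!)
  rw [heq]
  exact hmem r hr

theorem exists_adj_of_deg_one {p : ℕ} (hdeg : primeGraphDeg G p = 1) :
    ∃ r, primeGraphAdj G p r ∧ ∀ s, primeGraphAdj G p s → s = r := by
  classical
  have hdeg' := hdeg
  unfold primeGraphDeg at hdeg
  obtain ⟨r, hr⟩ := Finset.card_eq_one.1 hdeg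
  have h1 : primeGraphAdj G p r := by
    have : r ∈ ({r} : Finset ℕ) := Finset.mem_singleton_self r
    rw [← hr] at this
    exact (Finset.mem_filter.1 this).2
  refine ⟨r, h1, fun s hs => ?_⟩
  have := mem_of_deg {r} (by simpa using h1) (by simpa using hdeg') s hs
  simpa using this

theorem num31 : ∀ r ∈ [2, 3, 7, 11, 17, 67], ∀ j ∈ List.range 5, ∀ e ∈ [1, 2, 3, 5, 6, 10, 15, 30],
    (r ^ j * e) ∣ 2 ^ 4 * 3 ^ 2 * 7 ^ 2 * 11 ^ 2 * 17 * 67 ^ 3 → (r ^ j * e) % 31 = 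
    (2 ^ 4 * 3 ^ 2 * 7 ^ 2 * 11 ^ 2 * 17 * 67 ^ 3) % 31 → r = 7 := by
  decide +kernel

theorem adj31 (hcard : Nat.card G = 2 ^ 4 * 3 ^ 2 * 7 ^ 2 * 11 ^ 2 * 17 * 31 * 67 ^ 3)
    (hdeg31 : primeGraphDeg G 31 = 1) : ∃ r, primeGraphAdj G 31 r ∧ (∀ s, primeGraphAdj G 31 s → s = r) ∧ r = 7 := by
  obtain ⟨r, hr, hun⟩ := exists_adj_of_deg_one hdeg31
  refine ⟨r, hr, hun, ?_⟩
  have hF : Fact (Nat.Prime 31) := ⟨by norm_num⟩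
  obtain ⟨R⟩ : Nonempty (Sylow 31 G) := inferInstance
  have hRc : Nat.card (R : Subgroup G) = 31 := by
    obtain ⟨k, hk⟩ := R.2.exists_card_eq
    have h1 : 31 ∣ Nat.card (R : Subgroup G) := R.dvd_card_of_dvd_card (by rw [hcard]; norm_num)
    have h2 : Nat.card (R : Subgroup G) ∣ Nat.card G := Subgroup.card_subgroup_dvd_card _
    have h3 : k = 1 := by
      rcases Nat.lt_or_ge k 2 with h | h
      · interval_cases k
        · rw [hk] at h1; norm_num at h1
        · rfl
      · exfalso
        have : 31 ^ 2 ∣ Nat.card G := (pow_dvd_pow 31 h).trans (hk ▸ h2)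
        rw [hcard] at this; norm_num at this
    rw [hk, h3, pow_one]
  have hcyc : IsCyclic (R : Subgroup G) := isCyclic_of_prime_card hRc
  have key := Subgroup.card_dvd_of_injective _ (QuotientGroup.kerLift_injective (R : Subgroup G).normalizerMonoidHom)
  rw [Subgroup.normalizerMonoidHom_ker, ← Subgroup.index, ← Subgroup.relIndex, hcyc.card_mulAut, hRc] at key
  have hphi : Nat.totient 31 = 30 := by rw [Nat.totient_prime (by norm_num)]
  rw [hphi] at key
  set C := Subgroup.centralizer ((R : Subgroup G) : Set G) with hC
  set N := Subgroup.normalizer ((R : Subgroup G) : Set G) with hN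
  have hCN : C ≤ N := Subgroup.centralizer_le_normalizer _
  have hRC : (R : Subgroup G) ≤ C := R.1.le_centralizer
  have mulrel : ∀ H K : Subgroup G, H ≤ K → Nat.card H * H.relIndex K = Nat.card K := by
    intro H K h
    rw [← Subgroup.relIndex_bot_left, ← Subgroup.relIndex_bot_left]
    exact Subgroup.relIndex_mul_relIndex _ _ _ bot_le h
  have e1 : Nat.card C * C.relIndex N = Nat.card N := mulrel _ _ hCN
  have e2 : Nat.card N * Nat.card (Sylow 31 G) = Nat.card G := by
    rw [R.card_eq_index_normalizer]; exact Subgroup.card_mul_index _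
  have e3 := mulrel _ _ hRC
  rw [hRc] at e3
  have hmod : Nat.card (Sylow 31 G) % 31 = 1 := card_sylow_modEq_one 31 G
  generalize Nat.card (Sylow 31 G) = n at e2 hmod
  generalize C.relIndex N = e at e1 key
  generalize (R : Subgroup G).relIndex C = c at e3
  have htot : c * e * n = 2 ^ 4 * 3 ^ 2 * 7 ^ 2 * 11 ^ 2 * 17 * 67 ^ 3 := by
    have : 31 * (c * e * n) = 31 * (2 ^ 4 * 3 ^ 2 * 7 ^ 2 * 11 ^ 2 * 17 * 67 ^ 3) := by
      calc 31 * (c * e * n) = 31 * c * e * n := by ring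
        _ = Nat.card G := by rw [e3, e1, e2]
        _ = _ := by rw [hcard]; norm_num
    exact Nat.eq_of_mul_eq_mul_left (by norm_num) this
  have hcdvd : c ∣ 2 ^ 4 * 3 ^ 2 * 7 ^ 2 * 11 ^ 2 * 17 * 67 ^ 3 := ⟨e * n, by rw [← htot]; ring⟩
  have hc0 : c ≠ 0 := by
    rintro rfl
    norm_num at htot
  obtain ⟨x, hx⟩ := exists_prime_orderOf_dvd_card' (G := (R : Subgroup G)) 31 (by rw [hRc])
  have hcp : c = r ^ c.primeFactorsList.length := by
    refine Nat.eq_prime_pow_of_unique_prime_dvd hc0 ?_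
    intro d hd hdc
    have hFd : Fact d.Prime := ⟨hd⟩
    have hd31 : 31 ≠ d := by
      rintro rfl
      have := hdc.trans hcdvd
      norm_num at this
    obtain ⟨y, hy⟩ := exists_prime_orderOf_dvd_card' (G := C) d (by rw [← e3]; exact Dvd.dvd.mul_left hdc 31)
    apply hun
    refine adj_of_comm (by norm_num) hd hd31 (x := (x : G)) (y := (y : G)) (by simpa using hx) (by simpa using hy) ?_
    exact Subgroup.mem_centralizer_iff.1 y.2 x x.2
  set j := c.primeFactorsList.length
  have hrcase := primes_mem hcard hr.2.2.1 hr.2.2.2.2.1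
  have hr31 : 31 ≠ r := hr.1
  have hrmem : r ∈ [2, 3, 7, 11, 17, 67] := by
    rcases hrcase with rfl | rfl | rfl | rfl | rfl | rfl | rfl <;> first | decide | exact absurd rfl hr31
  have hj : j < 5 := by
    by_contra hj
    have h5 : r ^ 5 ∣ 2 ^ 4 * 3 ^ 2 * 7 ^ 2 * 11 ^ 2 * 17 * 67 ^ 3 :=
      (pow_dvd_pow r (not_lt.1 hj)).trans (hcp ▸ hcdvd)
    rcases hrcase with rfl | rfl | rfl | rfl | rfl | rfl | rfl <;> norm_num at h5
  have hemem : e ∈ [1, 2, 3, 5, 6, 10, 15, 30] := by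
    have : e ≤ 30 := Nat.le_of_dvd (by norm_num) key
    interval_cases e <;> first | decide | (exfalso; revert key; decide)
  refine num31 r hrmem j (List.mem_range.2 hj) e hemem ?_ ?_
  · rw [← hcp]; exact ⟨n, htot.symm⟩
  · rw [← hcp, ← htot, Nat.mul_mod (c * e) n, hmod, mul_one, Nat.mod_mod]

theorem adj67 (hcard : Nat.card G = 2 ^ 4 * 3 ^ 2 * 7 ^ 2 * 11 ^ 2 * 17 * 31 * 67 ^ 3)
    (hdeg2 : primeGraphDeg G 2 = 4)
    (hdeg7 : primeGraphDeg G 7 = 1)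
    (hdeg11 : primeGraphDeg G 11 = 4)
    (hdeg31 : primeGraphDeg G 31 = 1)
    (hdeg67 : primeGraphDeg G 67 = 2) (s : ℕ) (hs : primeGraphAdj G 67 s) : s = 2 ∨ s = 11 := by
  obtain ⟨r, hr, hun, rfl⟩ := adj31 hcard hdeg31
  obtain ⟨t, ht, hut⟩ := exists_adj_of_deg_one hdeg7
  have h31 := hut 31 (adj_symm hr)
  subst h31
  have h2 : primeGraphAdj G 2 67 := by
    refine adj_of_deg {3, 11, 17, 67} (fun q hq => ?_) (by rw [hdeg2]; rfl) 67 (by decide)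
    rcases primes_mem hcard hq.2.2.1 hq.2.2.2.2.1 with rfl | rfl | rfl | rfl | rfl | rfl | rfl
    · exact absurd rfl hq.1
    · decide
    · exact absurd (hut 2 (adj_symm hq)) (by norm_num)
    · decide
    · decide
    · exact absurd (hun 2 (adj_symm hq)) (by norm_num)
    · decide
  have h11 : primeGraphAdj G 11 67 := by
    refine adj_of_deg {2, 3, 17, 67} (fun q hq => ?_) (by rw [hdeg11]; rfl) 67 (by decide)
    rcases primes_mem hcard hq.2.2.1 hq.2.2.2.2.1 with rfl | rfl | rfl | rfl | rfl | rfl | rfl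
    · decide
    · decide
    · exact absurd (hut 11 (adj_symm hq)) (by norm_num)
    · exact absurd rfl hq.1
    · decide
    · exact absurd (hun 11 (adj_symm hq)) (by norm_num)
    · decide
  have := mem_of_deg {2, 11} (by
    intro q hq
    rcases Finset.mem_insert.1 hq with rfl | hq
    · exact adj_symm h2
    · rw [Finset.mem_singleton.1 hq]; exact adj_symm h11) (by rw [hdeg67]; rfl) s hs
  simpa using this

/-- The key graph-theoretic consequence. -/
def Sep (G : Type*) [Group G] : Prop := ∀ s : ℕ, s.Prime → s ≠ 67 → ∀ x y : G, x ≠ 1 →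
  (∃ k : ℕ, x ^ 67 ^ k = 1) → orderOf y = s → x * y = y * x → s = 2 ∨ s = 11

theorem sep_of (h : ∀ s, primeGraphAdj G 67 s → s = 2 ∨ s = 11) : Sep G := by
  intro s hs hs67 x y hx hk hy hxy
  have hp : Nat.Prime 67 := by norm_num
  have hF : Fact (Nat.Prime 67) := ⟨hp⟩
  obtain ⟨k, hk⟩ := hk
  obtain ⟨j, -, hj⟩ := (Nat.dvd_prime_pow hp).1 (orderOf_dvd_of_pow_eq_one hk)
  have hj0 : j ≠ 0 := by
    rintro rfl
    rw [pow_zero, orderOf_eq_one_iff] at hj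
    exact hx hj
  obtain ⟨i, rfl⟩ := Nat.exists_eq_succ_of_ne_zero hj0
  apply h
  refine adj_of_comm hp hs hs67.symm (x := x ^ 67 ^ i) (y := y) ?_ hy ?_
  · rw [orderOf_pow_of_dvd (by positivity) (by rw [hj]; exact pow_dvd_pow _ (Nat.le_succ i)), hj,
      pow_succ, Nat.mul_div_cancel_left _ (by positivity)]
  · have hc : Commute x y := hxy
    exact hc.pow_left _

/-- Fixed points of a coprime action. -/
theorem exists_fixed (K : Subgroup G) (s : ℕ) (hs : s.Prime) (g : G) (hg : orderOf g = s)
    (hgN : g ∈ Subgroup.normalizer (K : Set G)) (hK : Nat.card K % s ≠ 1) :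
    ∃ x ∈ K, x ≠ 1 ∧ g * x = x * g := by
  have hF : Fact s.Prime := ⟨hs⟩
  let g' : Subgroup.normalizer (K : Set G) := ⟨g, hgN⟩
  let A := Subgroup.zpowers g'
  let f : A →* MulAut K := K.normalizerMonoidHom.comp A.subtype
  let _ : MulAction A K := MulAction.compHom K f
  have hA : IsPGroup s A := by
    apply IsPGroup.of_card (n := 1)
    rw [Nat.card_zpowers, pow_one]
    rw [← hg]
    exact Subgroup.orderOf_mk g hgN
  have hm := hA.card_modEq_card_fixedPoints K
  by_contra hcon
  push Not at hcon
  apply hK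
  have hone : Nat.card (MulAction.fixedPoints A K) = 1 := by
    rw [Nat.card_eq_one_iff_unique]
    have h1 : (1 : K) ∈ MulAction.fixedPoints A K := by
      intro a
      exact map_one (f a)
    refine ⟨⟨?_⟩, ⟨1, h1⟩⟩
    have : ∀ z : MulAction.fixedPoints A K, z.1 = 1 := by
      rintro ⟨z, hz⟩
      by_contra hz1
      have hz2 : (z : G) ≠ 1 := fun h => hz1 (Subtype.ext h)
      refine hcon z z.2 hz2 ?_
      have h3 := congrArg Subtype.val (hz ⟨g', Subgroup.mem_zpowers g'⟩)
      have h4 : g * (z : G) * g⁻¹ = z := h3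
      rw [mul_inv_eq_iff_eq_mul] at h4
      exact h4
    intro a b
    exact Subtype.ext ((this a).trans (this b).symm)
  have h2 : Nat.card K % s = 1 % s := by rw [← hone]; exact hm
  rw [h2, Nat.mod_eq_of_lt hs.one_lt]
end graph
end OD

namespace OD

section graph
variable {G : Type*} [Group G] [Finite G]

instance fact67 : Fact (Nat.Prime 67) := ⟨by norm_num⟩

theorem num1936 : ∀ n ∈ List.range 1937, n ∣ 1936 → n % 67 = 1 → n = 1 := by decide +kernel

theorem num_ab : ∀ t ∈ List.range 1497, (1 + 300763 * t) ∣ 449939952 → t = 0 := by decide +kernel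

theorem num_non : ∀ t ∈ List.range 261, (12 + 67 * t) ∣ 17424 → t = 0 := by
  decide +kernel

theorem card_P (hcard : Nat.card G = 2 ^ 4 * 3 ^ 2 * 7 ^ 2 * 11 ^ 2 * 17 * 31 * 67 ^ 3)
    (P : Sylow 67 G) : Nat.card (P : Subgroup G) = 67 ^ 3 := by
  obtain ⟨k, hk⟩ := P.2.exists_card_eq
  have h1 : 67 ^ 3 ∣ Nat.card (P : Subgroup G) := P.pow_dvd_card_of_pow_dvd_card (by rw [hcard]; norm_num)
  have h2 : Nat.card (P : Subgroup G) ∣ Nat.card G := Subgroup.card_subgroup_dvd_card _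
  have h3 : k = 3 := by
    apply le_antisymm
    · by_contra h
      have : 67 ^ 4 ∣ Nat.card G := (pow_dvd_pow 67 (by omega)).trans (hk ▸ h2)
      rw [hcard] at this; norm_num at this
    · rw [hk] at h1
      exact (Nat.pow_dvd_pow_iff_le_right (by norm_num)).1 h1
  rw [hk, h3]

theorem part_hK (hcard : Nat.card G = 2 ^ 4 * 3 ^ 2 * 7 ^ 2 * 11 ^ 2 * 17 * 31 * 67 ^ 3)
    (hsep : Sep G) (P : Sylow 67 G) (x : G) (hx : x ∈ (P : Subgroup G))
    (hxc : ∀ y ∈ (P : Subgroup G), y * x = x * y) (hx1 : x ≠ 1) (y : G) (hxy : x * y = y * x)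
    (hy : ∃ k : ℕ, y ^ 67 ^ k = 1) : y ∈ (P : Subgroup G) := by
  set C := Subgroup.centralizer ({x} : Set G) with hC
  have memC : ∀ z : G, z ∈ C ↔ x * z = z * x := by
    intro z
    rw [hC, Subgroup.mem_centralizer_singleton_iff]
    exact ⟨fun h => h.symm, fun h => h.symm⟩
  have hPC : (P : Subgroup G) ≤ C := fun z hz => (memC z).2 (hxc z hz).symm
  have hxk : ∃ k : ℕ, x ^ 67 ^ k = 1 := by
    obtain ⟨k, hk⟩ := P.2 ⟨x, hx⟩
    exact ⟨k, congrArg Subtype.val hk⟩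
  have hnd : ∀ s : ℕ, s.Prime → s ≠ 67 → s ≠ 2 → s ≠ 11 → ¬ s ∣ Nat.card C := by
    intro s hs h1 h2 h3 hd
    have : Fact s.Prime := ⟨hs⟩
    obtain ⟨z, hz⟩ := exists_prime_orderOf_dvd_card' (G := C) s hd
    have := hsep s hs h1 x z hx1 hxk (by simpa using hz) ((memC _).1 z.2)
    tauto
  let Q : Sylow 67 C := P.subtype hPC
  have hQc : Nat.card (Q : Subgroup C) = 67 ^ 3 := by
    rw [← card_P hcard P]
    have : (Q : Subgroup C) = (P : Subgroup G).subgroupOf C := rfl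
    rw [this]
    exact Nat.card_congr (Subgroup.subgroupOfEquivOfLe hPC).toEquiv
  have hdvd := Q.card_dvd_index
  have hmul := Subgroup.card_mul_index (Q : Subgroup C)
  rw [hQc] at hmul
  have hCG : Nat.card C ∣ Nat.card G := Subgroup.card_subgroup_dvd_card _
  have hidx : (Q : Subgroup C).index ∣ 1936 := by
    have h1 : (Q : Subgroup C).index ∣ 232407 * 1936 := by
      apply Nat.dvd_of_mul_dvd_mul_left (k := 67 ^ 3) (by norm_num)
      rw [hmul]
      refine hCG.trans ?_
      rw [hcard]
      norm_num
    refine Nat.Coprime.dvd_of_dvd_mul_left ?_ h1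
    rw [show 232407 = 3 ^ 2 * 7 ^ 2 * 17 * 31 by norm_num]
    have cop : ∀ s : ℕ, s.Prime → s ≠ 67 → s ≠ 2 → s ≠ 11 → ((Q : Subgroup C).index).Coprime s := by
      intro s hs h1 h2 h3
      refine ((Nat.Prime.coprime_iff_not_dvd hs).2 fun h => ?_).symm
      exact hnd s hs h1 h2 h3 (h.trans ⟨67 ^ 3, by rw [← hmul]; ring⟩)
    have c3 := cop 3 (by norm_num) (by norm_num) (by norm_num) (by norm_num)
    have c7 := cop 7 (by norm_num) (by norm_num) (by norm_num) (by norm_num)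
    have c17 := cop 17 (by norm_num) (by norm_num) (by norm_num) (by norm_num)
    have c31 := cop 31 (by norm_num) (by norm_num) (by norm_num) (by norm_num)
    exact (((c3.pow_right 2).mul_right (c7.pow_right 2)).mul_right c17).mul_right c31
  have hmod : Nat.card (Sylow 67 C) % 67 = 1 := card_sylow_modEq_one 67 C
  have hn := hdvd.trans hidx
  have hone := num1936 _ (List.mem_range.2 (Nat.lt_succ_of_le (Nat.le_of_dvd (by norm_num) hn))) hn hmod
  have hsub : Subsingleton (Sylow 67 C) := (Nat.card_eq_one_iff_unique.1 hone).1
  let y' : C := ⟨y, (memC y).2 hxy⟩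
  have hyP : IsPGroup 67 (Subgroup.zpowers y') := by
    obtain ⟨k, hk⟩ := hy
    have h1 : y' ^ 67 ^ k = 1 := Subtype.ext hk
    obtain ⟨j, -, hj⟩ := (Nat.dvd_prime_pow (by norm_num : Nat.Prime 67)).1 (orderOf_dvd_of_pow_eq_one h1)
    exact IsPGroup.of_card (n := j) (by rw [Nat.card_zpowers, hj])
  obtain ⟨T, hT⟩ := hyP.exists_le_sylow
  have hTQ : T = Q := Subsingleton.elim _ _
  have h5 : y' ∈ (Q : Subgroup C) := hTQ ▸ hT (Subgroup.mem_zpowers y')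
  exact h5

theorem not_dvd_norm (hsep : Sep G) (P : Sylow 67 G) (K : Subgroup G) (hKP : K ≤ P)
    (hN : ∀ g ∈ Subgroup.normalizer ((P : Subgroup G) : Set G), g ∈ Subgroup.normalizer (K : Set G))
    (s : ℕ) (hs : s.Prime) (h67 : s ≠ 67) (h2 : s ≠ 2) (h11 : s ≠ 11) (hm : Nat.card K % s ≠ 1) :
    ¬ s ∣ Nat.card (Subgroup.normalizer ((P : Subgroup G) : Set G)) := by
  intro hd
  have : Fact s.Prime := ⟨hs⟩
  obtain ⟨g, hg⟩ := exists_prime_orderOf_dvd_card' (G := Subgroup.normalizer ((P : Subgroup G) : Set G)) s hd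
  have hg' : orderOf (g : G) = s := by simpa using hg
  obtain ⟨x, hx, hx1, hgx⟩ := exists_fixed K s hs g hg' (hN g g.2) hm
  have hxk : ∃ k : ℕ, x ^ 67 ^ k = 1 := by
    obtain ⟨k, hk⟩ := P.2 ⟨x, hKP hx⟩
    exact ⟨k, congrArg Subtype.val hk⟩
  have := hsep s hs h67 x g hx1 hxk hg' hgx.symm
  tauto

theorem part_nonab (hcard : Nat.card G = 2 ^ 4 * 3 ^ 2 * 7 ^ 2 * 11 ^ 2 * 17 * 31 * 67 ^ 3)
    (hsep : Sep G) (P : Sylow 67 G) :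
    ¬ ∀ x ∈ (P : Subgroup G), ∀ y ∈ (P : Subgroup G), x * y = y * x := by
  intro hab
  have habQ : ∀ Q : Sylow 67 G, ∀ x ∈ (Q : Subgroup G), ∀ y ∈ (Q : Subgroup G), x * y = y * x := by
    intro Q x hx y hy
    have e := Q.equiv P
    have h1 := hab _ (e ⟨x, hx⟩).2 _ (e ⟨y, hy⟩).2
    have h2 : e (⟨x, hx⟩ * ⟨y, hy⟩) = e (⟨y, hy⟩ * ⟨x, hx⟩) := by
      rw [map_mul, map_mul]; exact Subtype.ext h1
    exact congrArg Subtype.val (e.injective h2)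
  have hinf : ∀ Q : Sylow 67 G, Q ≠ P → (P ⊓ Q : Subgroup G) = ⊥ := by
    intro Q hQ
    by_contra hne
    obtain ⟨x, hx, hx1⟩ := (Subgroup.ne_bot_iff_exists_ne_one).1 hne |>.elim fun z hz =>
      (⟨z.1, z.2, fun h => hz (Subtype.ext h)⟩ : ∃ x, x ∈ (P ⊓ Q : Subgroup G) ∧ x ≠ 1)
    apply hQ
    refine Sylow_eq_of_le ?_
    intro y hy
    refine part_hK hcard hsep P x hx.1 (fun z hz => hab z hz x hx.1) hx1 y (habQ Q x hx.2 y hy) ?_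
    obtain ⟨k, hk⟩ := Q.2 ⟨y, hy⟩
    exact ⟨k, congrArg Subtype.val hk⟩
  classical
  have : Fintype (Sylow 67 G) := Fintype.ofFinite _
  have hd : 67 ^ 3 ∣ ((Finset.univ : Finset (Sylow 67 G)).erase P).card := by
    refine dvd_card_of_orbit (K := (P : Subgroup G)) _ _ ?_ ?_
    · intro k Q hQ
      refine Finset.mem_erase.2 ⟨fun h => (Finset.mem_erase.1 hQ).1 ?_, Finset.mem_univ _⟩
      have hkP : k • P = P := by
        have : (k : G) • P = P := Sylow.smul_eq_iff_mem_normalizer.2 (Subgroup.le_normalizer k.2)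
        exact this
      exact smul_left_cancel k (h.trans hkP.symm)
    · intro Q hQ
      have := orbit_card P Q
      rw [hinf Q (Finset.mem_erase.1 hQ).1, Subgroup.card_bot, mul_one, card_P hcard P] at this
      rw [this]
  have hn : Nat.card (Sylow 67 G) = 1 := by
    rw [Finset.card_erase_of_mem (Finset.mem_univ _), Finset.card_univ, ← Nat.card_eq_fintype_card] at hd
    obtain ⟨t, ht⟩ := hd
    have hpos : 0 < Nat.card (Sylow 67 G) := Nat.card_pos
    have hnt : Nat.card (Sylow 67 G) = 1 + 300763 * t := by omega
    have hidx : Nat.card (Sylow 67 G) ∣ 449939952 := by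
      have h1 := P.card_dvd_index
      have h2 := Subgroup.card_mul_index (P : Subgroup G)
      rw [card_P hcard P, hcard] at h2
      have h3 : (P : Subgroup G).index = 449939952 := by omega
      rwa [h3] at h1
    have hle := Nat.le_of_dvd (by norm_num) hidx
    rw [hnt] at hle hidx
    have := num_ab t (List.mem_range.2 (by omega)) hidx
    rw [hnt, this]
  have hN := Subgroup.card_mul_index (Subgroup.normalizer ((P : Subgroup G) : Set G))
  have h1 := P.card_eq_index_normalizer
  rw [hn] at h1
  refine not_dvd_norm hsep P P le_rfl (fun g hg => hg) 17 (by norm_num) (by norm_num) (by norm_num) (by norm_num)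
    (by rw [card_P hcard P]; norm_num) ?_
  have h2 : (Subgroup.normalizer ((P : Subgroup G) : Set G)).index = 1 := h1.symm
  rw [h2, mul_one] at hN
  rw [hN, hcard]
  norm_num

theorem card_Zc_aux {p : ℕ} [Fact p.Prime] (P : Sylow p G) (h3 : Nat.card (P : Subgroup G) = p ^ 3)
    (nonab : ¬ ∀ x ∈ (P : Subgroup G), ∀ y ∈ (P : Subgroup G), x * y = y * x) :
    Nat.card (Zc (P : Subgroup G)) = p := by
  have hp : p.Prime := Fact.out
  rw [Zc_eq_map, Nat.card_congr (Subgroup.equivMapOfInjective _ _ (Subgroup.subtype_injective _)).symm.toEquiv]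
  have hna : ¬ ∀ x y : (P : Subgroup G), x * y = y * x := by
    intro h
    apply nonab
    intro x hx y hy
    exact congrArg Subtype.val (h ⟨x, hx⟩ ⟨y, hy⟩)
  obtain ⟨k, hk0, hk⟩ := IsPGroup.card_center_eq_prime_pow (p := p) (G := (P : Subgroup G)) h3 (by norm_num)
  have hmul := Subgroup.card_mul_index (Subgroup.center (P : Subgroup G))
  rw [hk, h3] at hmul
  have hk3 : k ≤ 3 := (Nat.pow_dvd_pow_iff_le_right hp.one_lt).1 ⟨_, hmul.symm⟩
  have hcyc : ¬ IsCyclic ((P : Subgroup G) ⧸ Subgroup.center (P : Subgroup G)) := by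
    intro hc
    apply hna
    exact commutative_of_cyclic_center_quotient (QuotientGroup.mk' (Subgroup.center (P : Subgroup G))) (by simp)
  rw [hk]
  interval_cases k
  · simp
  · exfalso
    apply hcyc
    have : (Subgroup.center (P : Subgroup G)).index = p := by
      have : p ^ 2 * (Subgroup.center (P : Subgroup G)).index = p ^ 2 * p := by rw [hmul]; ring
      exact Nat.eq_of_mul_eq_mul_left (pow_pos hp.pos 2) this
    exact isCyclic_of_prime_card (p := p) this
  · exfalso
    apply hcyc
    have : (Subgroup.center (P : Subgroup G)).index = 1 := by
      have : p ^ 3 * (Subgroup.center (P : Subgroup G)).index = p ^ 3 * 1 := by rw [hmul]; ring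
      exact Nat.eq_of_mul_eq_mul_left (pow_pos hp.pos 3) this
    have : Subsingleton ((P : Subgroup G) ⧸ Subgroup.center (P : Subgroup G)) :=
      (Nat.card_eq_one_iff_unique.1 this).1
    infer_instance

theorem Zc_normalizer (P : Subgroup G) (g : G) (hg : g ∈ Subgroup.normalizer (P : Set G)) :
    g ∈ Subgroup.normalizer (Zc P : Set G) := by
  have hP : MulAut.conj g • P = P := by
    ext x
    rw [mem_conj]
    have := Subgroup.mem_normalizer_iff.1 ((Subgroup.normalizer (P : Set G)).inv_mem hg) x
    rw [inv_inv] at this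
    exact this.symm
  have h2 := Zc_conj g P
  rw [hP] at h2
  rw [Subgroup.mem_normalizer_iff]
  intro x
  have h3 : g * x * g⁻¹ ∈ MulAut.conj g • Zc P ↔ x ∈ Zc P := by
    rw [mem_conj]
    have : g⁻¹ * (g * x * g⁻¹) * g = x := by group
    rw [this]
  rw [← h2] at h3
  exact h3.symm

theorem card_sylow (hcard : Nat.card G = 2 ^ 4 * 3 ^ 2 * 7 ^ 2 * 11 ^ 2 * 17 * 31 * 67 ^ 3)
    (hsep : Sep G) : Nat.card (Sylow 67 G) = 309876 := by
  obtain ⟨P⟩ : Nonempty (Sylow 67 G) := inferInstance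
  have hZ := card_Zc_aux P (card_P hcard P) (part_nonab hcard hsep P)
  have hnd := not_dvd_norm hsep P (Zc P) (Zc_le _) (Zc_normalizer _)
  rw [hZ] at hnd
  have h7 := hnd 7 (by norm_num) (by norm_num) (by norm_num) (by norm_num) (by norm_num)
  have h17 := hnd 17 (by norm_num) (by norm_num) (by norm_num) (by norm_num) (by norm_num)
  have h31 := hnd 31 (by norm_num) (by norm_num) (by norm_num) (by norm_num) (by norm_num)
  have hN := Subgroup.card_mul_index (Subgroup.normalizer ((P : Subgroup G) : Set G))
  have h1 : Nat.card (Sylow 67 G) = (Subgroup.normalizer ((P : Subgroup G) : Set G)).index := P.card_eq_index_normalizer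
  rw [← h1, hcard] at hN
  have hmod : Nat.card (Sylow 67 G) % 67 = 1 := card_sylow_modEq_one 67 G
  have hidx : Nat.card (Sylow 67 G) ∣ 449939952 := by
    have h1 := P.card_dvd_index
    have h2 := Subgroup.card_mul_index (P : Subgroup G)
    rw [card_P hcard P, hcard] at h2
    have h3 : (P : Subgroup G).index = 449939952 := by omega
    rwa [h3] at h1
  generalize Nat.card (Sylow 67 G) = n at *
  generalize Nat.card (Subgroup.normalizer ((P : Subgroup G) : Set G)) = N at *
  have hdv : 25823 ∣ n := by
    have c7 := (Nat.Prime.coprime_iff_not_dvd (by norm_num : Nat.Prime 7)).2 h7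
    have c17 := (Nat.Prime.coprime_iff_not_dvd (by norm_num : Nat.Prime 17)).2 h17
    have c31 := (Nat.Prime.coprime_iff_not_dvd (by norm_num : Nat.Prime 31)).2 h31
    have c : Nat.Coprime 25823 N := by
      rw [show 25823 = 7 ^ 2 * 17 * 31 by norm_num]
      exact ((c7.pow_left 2).mul_left c17).mul_left c31
    refine c.dvd_of_dvd_mul_left ?_
    rw [hN]
    norm_num
  obtain ⟨d, rfl⟩ := hdv
  have hd : d ∣ 17424 := by
    apply Nat.dvd_of_mul_dvd_mul_left (k := 25823) (by norm_num)
    exact hidx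
  have hdle := Nat.le_of_dvd (by norm_num) hd
  obtain ⟨t, rfl⟩ : ∃ t, d = 12 + 67 * t := ⟨d / 67, by omega⟩
  have := num_non t (List.mem_range.2 (by omega)) hd
  rw [this]

theorem hyp_of (hcard : Nat.card G = 2 ^ 4 * 3 ^ 2 * 7 ^ 2 * 11 ^ 2 * 17 * 31 * 67 ^ 3)
    (hsep : Sep G) : Hyp G 67 where
  hp3 := by norm_num
  card := card_P hcard
  nonab := part_nonab hcard hsep
  hK := part_hK hcard hsep
  nS := by rw [card_sylow hcard hsep]; norm_num
  h8 := by
    intro P h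
    have hN := Subgroup.card_mul_index (Subgroup.normalizer ((P : Subgroup G) : Set G))
    have h1 : Nat.card (Sylow 67 G) = (Subgroup.normalizer ((P : Subgroup G) : Set G)).index := P.card_eq_index_normalizer
    rw [← h1, hcard, card_sylow hcard hsep] at hN
    have h' : 8 ∣ Nat.card (Subgroup.normalizer ((P : Subgroup G) : Set G)) := h
    omega

end graph
end OD

theorem L3_67_OD_characterizable (G : Type*) [Group G] [Finite G]
    (hcard : Nat.card G = 2 ^ 4 * 3 ^ 2 * 7 ^ 2 * 11 ^ 2 * 17 * 31 * 67 ^ 3)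
    (hdeg2 : primeGraphDeg G 2 = 4)
    (hdeg3 : primeGraphDeg G 3 = 2)
    (hdeg7 : primeGraphDeg G 7 = 1)
    (hdeg11 : primeGraphDeg G 11 = 4)
    (hdeg17 : primeGraphDeg G 17 = 2)
    (hdeg31 : primeGraphDeg G 31 = 1)
    (hdeg67 : primeGraphDeg G 67 = 2) :
    Nonempty (G ≃* PSL(3, ZMod 67)) := by
  exact OD.finish (OD.hyp_of hcard (OD.sep_of
    (OD.adj67 hcard hdeg2 hdeg7 hdeg11 hdeg31 hdeg67))) hcard
end

section
/- Let G be a finite group with |G| = 2⁵·3·7·11²·23³·79 and degree pattern D(G) = (3,2,1,3,2,1), i.e., deg_G(2)=3, deg_G(3)=2, deg_G(7)=1, deg_G(11)=3, deg_G(23)=2, deg_G(79)=1. Then every solvable normal subgroup K of G satisfies π(K) ⊆ {2,3,11,23}; in particular, neither 7 nor 79 divides |K|. -/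
open scoped MatrixGroups

theorem exists_orderOf_of_dvd {G : Type*} [Group G] [Finite G] {n : ℕ} {g : G}
    (h : n ∣ orderOf g) : ∃ x : G, orderOf x = n :=
  ⟨g ^ (orderOf g / n), orderOf_pow_orderOf_div (orderOf_pos g).ne' h⟩

theorem commutator_lt {G : Type*} [Group G] (K : Subgroup G) [Group.IsSolvable K] (hb : K ≠ ⊥) :
    ⁅K, K⁆ < K := by
  have : Nontrivial K := (Subgroup.nontrivial_iff_ne_bot K).mpr hb
  have h := Group.IsSolvable.commutator_lt_top_of_nontrivial K
  refine lt_of_le_of_ne (Subgroup.commutator_le_self K) fun he => h.ne ?_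
  apply Subgroup.map_injective K.subtype_injective
  rw [commutator_def, Subgroup.map_commutator, ← MonoidHom.range_eq_map, Subgroup.range_subtype, he]

/-- A nontrivial solvable normal subgroup contains a nontrivial abelian normal subgroup. -/
theorem exists_abelian_normal {G : Type*} [Group G] [Finite G] (K : Subgroup G) :
    K.Normal → Group.IsSolvable K → K ≠ ⊥ →
      ∃ A : Subgroup G, A ≤ K ∧ A.Normal ∧ A ≠ ⊥ ∧ ⁅A, A⁆ = ⊥ := by
  induction K using WellFoundedLT.induction with
  | ind K ih =>
    intro hn hs hb
    by_cases hc : ⁅K, K⁆ = ⊥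
    · exact ⟨K, le_rfl, hn, hb, hc⟩
    · have hlt : ⁅K, K⁆ < K := commutator_lt K hb
      have hs' : Group.IsSolvable (⁅K, K⁆ : Subgroup G) :=
        Group.isSolvable_of_isSolvable_injective (Subgroup.inclusion_injective hlt.le)
      obtain ⟨A, h1, h2⟩ := ih _ hlt inferInstance hs' hc
      exact ⟨A, h1.trans hlt.le, h2⟩

/-- An element of order `r` acting on a normal `p`-subgroup whose order is not `1` mod `r`. -/
theorem exists_of_normal_pgroup {G : Type*} [Group G] [Finite G] {p r : ℕ}
    (hp : p.Prime) (hr : r.Prime) (hpr : p ≠ r) (P : Subgroup G) (hP : P.Normal)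
    (hpP : IsPGroup p P) (hmod : ¬ Nat.card P ≡ 1 [MOD r]) (hrG : r ∣ Nat.card G) :
    ∃ g : G, orderOf g = p * r := by
  have := Fact.mk hp
  have := Fact.mk hr
  obtain ⟨x, hx⟩ := exists_prime_orderOf_dvd_card' r hrG
  let : MulAction (Subgroup.zpowers x) P :=
    MulAction.compHom P ((MulAut.conjNormal (H := P)).comp (Subgroup.zpowers x).subtype)
  have hX : IsPGroup r (Subgroup.zpowers x) :=
    IsPGroup.of_card (n := 1) (by rw [Nat.card_zpowers, hx, pow_one])
  have hfix := hX.card_modEq_card_fixedPoints P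
  have hex : ∃ y : P, y ∈ MulAction.fixedPoints (Subgroup.zpowers x) P ∧ y ≠ 1 := by
    by_contra hcon
    push Not at hcon
    have h1 : (1 : P) ∈ MulAction.fixedPoints (Subgroup.zpowers x) P := by
      intro g
      exact map_one (MulAut.conjNormal (H := P) (g : G))
    have : MulAction.fixedPoints (Subgroup.zpowers x) P = {1} := by
      ext y
      exact ⟨fun h => hcon y h, fun h => h ▸ h1⟩
    rw [this] at hfix
    apply hmod
    simpa using hfix
  obtain ⟨y, hy, hy1⟩ := hex
  have hcomm : x * (y : G) * x⁻¹ = y := by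
    have h := hy ⟨x, Subgroup.mem_zpowers x⟩
    have h2 : ((MulAut.conjNormal (H := P) x y : P) : G) = y := congrArg Subtype.val h
    rwa [MulAut.conjNormal_apply] at h2
  have hc : Commute (y : G) x := by
    have := mul_inv_eq_iff_eq_mul.mp hcomm
    exact this.symm
  obtain ⟨k, hk⟩ := IsPGroup.iff_orderOf.mp hpP y
  have hk' : orderOf (y : G) = p ^ k := by rw [Subgroup.orderOf_coe, hk]
  have hk0 : k ≠ 0 := by
    rintro rfl
    exact hy1 (orderOf_eq_one_iff.mp (by simpa using hk))
  have hcop : (orderOf (y : G)).Coprime (orderOf x) := by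
    rw [hk', hx]
    exact Nat.Coprime.pow_left _ ((Nat.coprime_primes hp hr).mpr hpr)
  have ho := hc.orderOf_mul_eq_mul_orderOf_of_coprime hcop
  apply exists_orderOf_of_dvd (g := (y : G) * x)
  rw [ho, hk', hx]
  exact Nat.mul_dvd_mul_right (dvd_pow_self p hk0) r

/-- The case where `p` divides the order of an abelian normal subgroup. -/
theorem exists_of_abelian_normal {G : Type*} [Group G] [Finite G] {p r : ℕ}
    (hp : p.Prime) (hr : r.Prime) (hpr : p ≠ r) (A : Subgroup G) (hA : A.Normal)
    (hAc : ⁅A, A⁆ = ⊥) (hpA : p ∣ Nat.card A)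
    (hmod : ∀ k, k ≠ 0 → p ^ k ∣ Nat.card G → ¬ p ^ k ≡ 1 [MOD r]) (hrG : r ∣ Nat.card G) :
    ∃ g : G, orderOf g = p * r := by
  have := Fact.mk hp
  obtain ⟨P⟩ : Nonempty (Sylow p A) := inferInstance
  have hcomm : ∀ a b : A, a * b = b * a := by
    intro a b
    have := Subgroup.commutator_eq_bot_iff_le_centralizer.mp hAc a.2
    exact Subtype.ext ((Subgroup.mem_centralizer_iff.mp this b b.2).symm)
  have hPn : (P : Subgroup A).Normal :=
    ⟨fun n hn g => by rw [hcomm g n, mul_assoc, mul_inv_cancel, mul_one]; exact hn⟩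
  have hPc : (P : Subgroup A).Characteristic := Sylow.characteristic_of_normal P hPn
  have hQ : ((P : Subgroup A).map A.subtype).Normal := inferInstance
  have hcardQ : Nat.card ((P : Subgroup A).map A.subtype) = p ^ (Nat.card A).factorization p := by
    rw [Subgroup.card_map_of_injective A.subtype_injective]
    exact P.card_eq_multiplicity
  refine exists_of_normal_pgroup hp hr hpr _ hQ (IsPGroup.of_card hcardQ) ?_ hrG
  rw [hcardQ]
  apply hmod
  · exact (hp.factorization_pos_of_dvd Nat.card_pos.ne' hpA).ne'
  · exact (Nat.ordProj_dvd _ _).trans (Subgroup.card_subgroup_dvd_card A)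

theorem exists_of_solvable_normal {p r : ℕ} (hp : p.Prime) (hr : r.Prime) (hpr : p ≠ r) (n : ℕ) :
    ∀ (G : Type*) [Group G] [Finite G], Nat.card G = n → ∀ K : Subgroup G, K.Normal →
      Group.IsSolvable K → p ∣ Nat.card K → r ∣ Nat.card G →
      (∀ k, k ≠ 0 → p ^ k ∣ Nat.card G → ¬ p ^ k ≡ 1 [MOD r]) →
      (∀ k, k ≠ 0 → r ^ k ∣ Nat.card G → ¬ r ^ k ≡ 1 [MOD p]) →
      ∃ g : G, orderOf g = p * r := by
  induction n using Nat.strong_induction_on with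
  | _ n ih =>
    intro G _ _ hG K hK hs hpK hrG h1 h2
    have hb : K ≠ ⊥ := by
      rintro rfl
      rw [Subgroup.card_bot] at hpK
      exact hp.one_lt.ne' (Nat.dvd_one.mp hpK)
    obtain ⟨A, hAK, hA, hAb, hAc⟩ := exists_abelian_normal K hK hs hb
    have hpG : p ∣ Nat.card G := hpK.trans (Subgroup.card_subgroup_dvd_card K)
    by_cases hpA : p ∣ Nat.card A
    · exact exists_of_abelian_normal hp hr hpr A hA hAc hpA h1 hrG
    by_cases hrA : r ∣ Nat.card A
    · rw [mul_comm]
      exact exists_of_abelian_normal hr hp hpr.symm A hA hAc hrA h2 hpG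
    have hmul := Subgroup.card_eq_card_quotient_mul_card_subgroup A
    have hdvd : Nat.card (G ⧸ A) ∣ Nat.card G := ⟨_, hmul⟩
    have hlt : Nat.card (G ⧸ A) < n := by
      rw [← hG, hmul]
      have : 1 < Nat.card A := (Subgroup.one_lt_card_iff_ne_bot A).mpr hAb
      exact lt_mul_of_one_lt_right Nat.card_pos this
    have hrQ : r ∣ Nat.card (G ⧸ A) := by
      rw [hmul] at hrG
      exact (hr.dvd_mul.mp hrG).resolve_right hrA
    let f := (QuotientGroup.mk' A).subgroupMap K
    have hf : Function.Surjective f := (QuotientGroup.mk' A).subgroupMap_surjective K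
    have hpQ : p ∣ Nat.card (K.map (QuotientGroup.mk' A)) := by
      have e := Subgroup.card_mul_index (f.ker)
      rw [Subgroup.index_ker, f.range_eq_top.mpr hf, Subgroup.card_top] at e
      rw [← e] at hpK
      refine (hp.dvd_mul.mp hpK).resolve_left fun h => hpA (h.trans ?_)
      rw [← Subgroup.card_map_of_injective K.subtype_injective]
      apply Subgroup.card_dvd_of_le
      rintro _ ⟨y, hy, rfl⟩
      have hy' : QuotientGroup.mk' A (y : G) = 1 := congrArg Subtype.val hy
      exact (QuotientGroup.eq_one_iff _).mp hy'
    obtain ⟨g, hg⟩ := ih _ hlt (G ⧸ A) rfl (K.map (QuotientGroup.mk' A))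
      (hK.map _ (QuotientGroup.mk'_surjective A)) (Group.isSolvable_of_surjective hf) hpQ hrQ
      (fun k hk h => h1 k hk (h.trans hdvd)) (fun k hk h => h2 k hk (h.trans hdvd))
    obtain ⟨x, rfl⟩ := QuotientGroup.mk'_surjective A g
    apply exists_orderOf_of_dvd (g := x)
    rw [← hg]
    exact orderOf_map_dvd _ x

theorem solvable_normal_pi_subset_L3_23 (G : Type*) [Group G] [Finite G]
    (hcard : Nat.card G = 2 ^ 5 * 3 * 7 * 11 ^ 2 * 23 ^ 3 * 79)
    (hdeg2 : primeGraphDeg G 2 = 3) (hdeg3 : primeGraphDeg G 3 = 2)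
    (hdeg7 : primeGraphDeg G 7 = 1) (hdeg11 : primeGraphDeg G 11 = 3)
    (hdeg23 : primeGraphDeg G 23 = 2) (hdeg79 : primeGraphDeg G 79 = 1) :
    ∀ K : Subgroup G, K.Normal → IsSolvable K →
      (Nat.card K).primeFactors ⊆ {2, 3, 11, 23} ∧
        ¬ 7 ∣ Nat.card K ∧ ¬ 79 ∣ Nat.card K := by
  intro K hK hs
  have hN : ∀ q k m : ℕ, Nat.card G = q ^ m * (Nat.card G / q ^ m) → q.Prime →
      ¬ q ∣ Nat.card G / q ^ m → q ^ k ∣ Nat.card G → k ≤ m := by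
    intro q k m he hq hnd hd
    by_contra hlt
    push Not at hlt
    have h1 : q ^ (m + 1) ∣ Nat.card G := (pow_dvd_pow q hlt).trans hd
    rw [he, pow_succ] at h1
    exact hnd (Nat.dvd_of_mul_dvd_mul_left (pow_pos hq.pos m) h1)
  have v7 : ∀ k, 7 ^ k ∣ Nat.card G → k ≤ 1 := fun k =>
    hN 7 k 1 (by rw [hcard]; norm_num) (by norm_num) (by rw [hcard]; norm_num)
  have v79 : ∀ k, 79 ^ k ∣ Nat.card G → k ≤ 1 := fun k =>
    hN 79 k 1 (by rw [hcard]; norm_num) (by norm_num) (by rw [hcard]; norm_num)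
  have v11 : ∀ k, 11 ^ k ∣ Nat.card G → k ≤ 2 := fun k =>
    hN 11 k 2 (by rw [hcard]; norm_num) (by norm_num) (by rw [hcard]; norm_num)
  have two : ∀ p a b : ℕ, primeGraphDeg G p = 1 → a ≠ b → primeGraphAdj G p a →
      primeGraphAdj G p b → False := by
    intro p a b hd hab ha hb
    have hpos : Nat.card G ≠ 0 := Nat.card_pos.ne'
    classical
    unfold primeGraphDeg at hd
    obtain ⟨c, hc⟩ := Finset.card_eq_one.mp hd
    have key : ∀ r, primeGraphAdj G p r → r = c := by
      intro r h
      rw [← Finset.mem_singleton, ← hc]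
      refine Finset.mem_filter.mpr ?_
      exact ⟨Nat.mem_primeFactors.mpr ⟨h.2.2.1, h.2.2.2.2.1, hpos⟩, h⟩
    exact hab ((key a ha).trans (key b hb).symm)
  have d7 : 7 ∣ Nat.card G := by rw [hcard]; norm_num
  have d11 : 11 ∣ Nat.card G := by rw [hcard]; norm_num
  have d79 : 79 ∣ Nat.card G := by rw [hcard]; norm_num
  have p7 : Nat.Prime 7 := by norm_num
  have p11 : Nat.Prime 11 := by norm_num
  have p79 : Nat.Prime 79 := by norm_num
  have m7 : ∀ r, r = 11 ∨ r = 79 → ∀ k, k ≠ 0 → 7 ^ k ∣ Nat.card G → ¬ 7 ^ k ≡ 1 [MOD r] := by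
    intro r hr k hk h
    have := v7 k h
    obtain rfl : k = 1 := by omega
    rcases hr with rfl | rfl <;> decide
  have m79 : ∀ r, r = 11 ∨ r = 7 → ∀ k, k ≠ 0 → 79 ^ k ∣ Nat.card G → ¬ 79 ^ k ≡ 1 [MOD r] := by
    intro r hr k hk h
    have := v79 k h
    obtain rfl : k = 1 := by omega
    rcases hr with rfl | rfl <;> decide
  have m11 : ∀ r, r = 7 ∨ r = 79 → ∀ k, k ≠ 0 → 11 ^ k ∣ Nat.card G → ¬ 11 ^ k ≡ 1 [MOD r] := by
    intro r hr k hk h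
    have := v11 k h
    obtain rfl | rfl : k = 1 ∨ k = 2 := by omega
    all_goals rcases hr with rfl | rfl <;> decide
  have n7 : ¬ 7 ∣ Nat.card K := by
    intro h
    refine two 7 11 79 hdeg7 (by norm_num) ⟨by norm_num, p7, p11, d7, d11, ?_⟩
      ⟨by norm_num, p7, p79, d7, d79, ?_⟩
    · exact exists_of_solvable_normal p7 p11 (by norm_num) _ G rfl K hK hs h d11
        (m7 11 (Or.inl rfl)) (m11 7 (Or.inl rfl))
    · exact exists_of_solvable_normal p7 p79 (by norm_num) _ G rfl K hK hs h d79
        (m7 79 (Or.inr rfl)) (m79 7 (Or.inr rfl))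
  have n79 : ¬ 79 ∣ Nat.card K := by
    intro h
    refine two 79 11 7 hdeg79 (by norm_num) ⟨by norm_num, p79, p11, d79, d11, ?_⟩
      ⟨by norm_num, p79, p7, d79, d7, ?_⟩
    · exact exists_of_solvable_normal p79 p11 (by norm_num) _ G rfl K hK hs h d11
        (m79 11 (Or.inl rfl)) (m11 79 (Or.inr rfl))
    · exact exists_of_solvable_normal p79 p7 (by norm_num) _ G rfl K hK hs h d7
        (m79 7 (Or.inr rfl)) (m7 79 (Or.inr rfl))
  refine ⟨?_, n7, n79⟩
  intro q hq
  obtain ⟨hqp, hqd, -⟩ := Nat.mem_primeFactors.mp hq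
  have hqG : q ∣ Nat.card G := hqd.trans (Subgroup.card_subgroup_dvd_card K)
  rw [hcard] at hqG
  have e : ∀ s : ℕ, s.Prime → q ∣ s → q = s := fun s hs' h => (Nat.prime_dvd_prime_iff_eq hqp hs').mp h
  simp only [Finset.mem_insert, Finset.mem_singleton]
  rcases hqp.dvd_mul.mp hqG with hqG | h
  · rcases hqp.dvd_mul.mp hqG with hqG | h
    · rcases hqp.dvd_mul.mp hqG with hqG | h
      · rcases hqp.dvd_mul.mp hqG with hqG | h
        · rcases hqp.dvd_mul.mp hqG with h | h
          · exact Or.inl (e 2 Nat.prime_two (hqp.dvd_of_dvd_pow h))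
          · exact Or.inr (Or.inl (e 3 Nat.prime_three h))
        · exact absurd (e 7 p7 h ▸ hqd) n7
      · exact Or.inr (Or.inr (Or.inl (e 11 p11 (hqp.dvd_of_dvd_pow h))))
    · exact Or.inr (Or.inr (Or.inr (e 23 (by norm_num) (hqp.dvd_of_dvd_pow h))))
  · exact absurd (e 79 p79 h ▸ hqd) n79
end
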